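/- arXiv:2102.12830 — 3 statements merged into one kernel-verified Lean document; each statement's English description precedes it below -/
import Mathlib

section
/- Fix an integer ℓ ≥ 9 that is divisible by 3 and not divisible by 4. For every ε > 0 there exist δ > 0 and n₀ such that every oriented graph H on n ≥ n₀ vertices with minimum semidegree δ±(H) ≥ n/4 − δ·n that contains no closed directed walk of length ℓ can be made bipartite by removing at most ε·n vertices; that is, there exists a set S of at most ε·n vertices and a partition of the remaining vertices into two classes such that every edge of H with both endpoints outside S joins the two classes. -/
/-- The outdegree of a vertex `v` in the directed graph with edge relation `E`. -/
noncomputable def outDeg {n : ℕ} (E : Fin n → Fin n → Prop) (v : Fin n) : ℕ :=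
  {w | E v w}.ncard

/-- The indegree of a vertex `v` in the directed graph with edge relation `E`. -/
noncomputable def inDeg {n : ℕ} (E : Fin n → Fin n → Prop) (v : Fin n) : ℕ :=
  {w | E w v}.ncard

/-- The semidegree of a vertex: the minimum of its outdegree and indegree. -/
noncomputable def semiDeg {n : ℕ} (E : Fin n → Fin n → Prop) (v : Fin n) : ℕ :=
  min (outDeg E v) (inDeg E v)

/-- `E` is an oriented graph: no loops and no pair of opposite edges. -/
def Oriented {n : ℕ} (E : Fin n → Fin n → Prop) : Prop :=
  (∀ v, ¬ E v v) ∧ (∀ u v, E u v → ¬ E v u)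

/-- The graph contains a directed cycle of length exactly `t`:
`t` distinct vertices cyclically joined by edges. -/
def HasDiCycle {n : ℕ} (E : Fin n → Fin n → Prop) (t : ℕ) : Prop :=
  ∃ v : ZMod t → Fin n, Function.Injective v ∧ ∀ i, E (v i) (v (i + 1))

/-- The graph contains a closed directed walk of length `t` (vertices may repeat). -/
def HasClosedWalk {n : ℕ} (E : Fin n → Fin n → Prop) (t : ℕ) : Prop :=
  ∃ w : ℕ → Fin n, w 0 = w t ∧ ∀ i < t, E (w i) (w (i + 1))

/-- There is a directed path of length `t` from `x` to `y` (all vertices distinct). -/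
def HasPath {n : ℕ} (E : Fin n → Fin n → Prop) (x y : Fin n) (t : ℕ) : Prop :=
  ∃ u : Fin (t + 1) → Fin n, Function.Injective u ∧ u 0 = x ∧ u (Fin.last t) = y ∧
    ∀ i : Fin t, E (u i.castSucc) (u i.succ)

/-- The graph contains an `s`-shortcut: a directed path `v₀ v₁ ⋯ v_s` on distinct
vertices together with the additional edge `v₀ v_s`. -/
def HasShortcut {n : ℕ} (E : Fin n → Fin n → Prop) (s : ℕ) : Prop :=
  ∃ v : Fin (s + 1) → Fin n, Function.Injective v ∧
    (∀ i : Fin s, E (v i.castSucc) (v i.succ)) ∧ E (v 0) (v (Fin.last s))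

/-- The graph is homomorphic to the directed cycle `C_k`. -/
def HomToCycle {n : ℕ} (E : Fin n → Fin n → Prop) (k : ℕ) : Prop :=
  ∃ f : Fin n → ZMod k, ∀ u v, E u v → f v = f u + 1

/-! ### Finite sets -/

/-- The cardinality of a finite set, as a real number. -/
def size {V : Type*} (A : Finset V) : ℝ := (A.card : ℝ)

lemma size_nonneg {V : Type*} (A : Finset V) : 0 ≤ size A := Nat.cast_nonneg _

lemma size_mono {V : Type*} {A B : Finset V} (h : A ⊆ B) : size A ≤ size B := by
  unfold size
  exact_mod_cast Finset.card_le_card h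

lemma size_pos {V : Type*} {A : Finset V} : 0 < size A ↔ A.Nonempty := by
  simp [size, Finset.card_pos]

lemma size_union_of_disjoint {V : Type*} [DecidableEq V] {A B : Finset V}
    (h : ∀ z ∈ A, z ∉ B) : size (A ∪ B) = size A + size B := by
  unfold size
  rw [Finset.card_union_of_disjoint (Finset.disjoint_left.2 fun z hA hB => h z hA hB)]
  push_cast
  rfl

lemma size_inter_eq_zero {V : Type*} [DecidableEq V] {A B : Finset V}
    (h : ∀ z ∈ A, z ∉ B) : size (A ∩ B) = 0 := by
  unfold size
  rw [Finset.disjoint_iff_inter_eq_empty.1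
    (Finset.disjoint_left.2 fun z hA hB => h z hA hB)]
  simp

lemma exists_mem_of_size_inter_pos {V : Type*} [DecidableEq V] {A B : Finset V}
    (h : 0 < size (A ∩ B)) : ∃ z ∈ A, z ∈ B := by
  obtain ⟨z, hz⟩ := size_pos.1 h
  exact ⟨z, (Finset.mem_inter.1 hz).1, (Finset.mem_inter.1 hz).2⟩

lemma size_inter_add_le {V : Type*} [DecidableEq V] {A S T : Finset V}
    (h : ∀ z ∈ A, z ∈ S → z ∉ T) : size (A ∩ S) + size (A ∩ T) ≤ size A := by
  rw [← size_union_of_disjoint]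
  · exact size_mono (Finset.union_subset Finset.inter_subset_left Finset.inter_subset_left)
  · intro z hz hz'
    simp only [Finset.mem_inter] at hz hz'
    exact h z hz.1 hz.2 hz'.2

lemma exists_mem_of_size_lt {V : Type*} [DecidableEq V] {A S T : Finset V}
    (h : size A < size (A ∩ S) + size (A ∩ T)) : ∃ z ∈ A, z ∈ S ∧ z ∈ T := by
  by_contra! hc
  exact absurd (size_inter_add_le hc) (not_le.2 h)

lemma size_add_le_card {V : Type*} [Fintype V] [DecidableEq V] {A B : Finset V}
    (h : ∀ z ∈ A, z ∉ B) : size A + size B ≤ Fintype.card V := by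
  rw [← size_union_of_disjoint h]
  unfold size
  exact_mod_cast Finset.card_le_univ _

lemma size_inter_add_sdiff {V : Type*} [DecidableEq V] (A B : Finset V) :
    size (A ∩ B) + size (A \ B) = size A := by
  unfold size
  exact_mod_cast Finset.card_inter_add_card_sdiff A B

lemma size_inter_add_inter_le {V : Type*} [DecidableEq V] (A S T : Finset V) :
    size (A ∩ S) + size (A ∩ T) ≤ size A + size (S ∩ T) := by
  have h1 := size_inter_add_sdiff A S
  have h2 := size_inter_add_sdiff (A ∩ T) S
  have h3 : size ((A ∩ T) ∩ S) ≤ size (S ∩ T) := size_mono (by grind)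
  have h4 : size ((A ∩ T) \ S) ≤ size (A \ S) := size_mono (by grind)
  linarith

/-- Four pairwise disjoint sets of almost a quarter of all elements each: their sizes are
controlled, and they cover almost everything. -/
structure Quarters {V : Type*} [Fintype V] [DecidableEq V] (A B C D : Finset V) (e : ℝ) :
    Prop where
  size_A : size A ≤ Fintype.card V / 4 + 3 * e
  size_B : size B ≤ Fintype.card V / 4 + 3 * e
  size_C : size C ≤ Fintype.card V / 4 + 3 * e
  size_D : size D ≤ Fintype.card V / 4 + 3 * e
  cover : ∀ T, size T ≤ size (A ∩ T) + size (B ∩ T) + size (C ∩ T) + size (D ∩ T) + 4 * e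

lemma Quarters.of_disjoint {V : Type*} [Fintype V] [DecidableEq V] {A B C D : Finset V} {e : ℝ}
    (hA : (Fintype.card V : ℝ) / 4 - e ≤ size A) (hB : (Fintype.card V : ℝ) / 4 - e ≤ size B)
    (hC : (Fintype.card V : ℝ) / 4 - e ≤ size C) (hD : (Fintype.card V : ℝ) / 4 - e ≤ size D)
    (hAB : ∀ z ∈ A, z ∉ B) (hAC : ∀ z ∈ A, z ∉ C) (hAD : ∀ z ∈ A, z ∉ D)
    (hBC : ∀ z ∈ B, z ∉ C) (hBD : ∀ z ∈ B, z ∉ D) (hCD : ∀ z ∈ C, z ∉ D) :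
    Quarters A B C D e := by
  have h1 := size_union_of_disjoint hAB
  have h2 : size ((A ∪ B) ∪ C) = _ := size_union_of_disjoint (by grind)
  have h3 : size (((A ∪ B) ∪ C) ∪ D) = _ := size_union_of_disjoint (by grind)
  have hle : size (((A ∪ B) ∪ C) ∪ D) ≤ Fintype.card V := by
    unfold size
    exact_mod_cast Finset.card_le_univ _
  refine ⟨by linarith, by linarith, by linarith, by linarith, fun T => ?_⟩
  have k1 : size (A ∩ T ∪ B ∩ T) = _ := size_union_of_disjoint (by grind)
  have k2 : size (A ∩ T ∪ B ∩ T ∪ C ∩ T) = _ := size_union_of_disjoint (by grind)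
  have k3 : size (A ∩ T ∪ B ∩ T ∪ C ∩ T ∪ D ∩ T) = _ := size_union_of_disjoint (by grind)
  have k4 := size_inter_add_sdiff T (((A ∪ B) ∪ C) ∪ D)
  have k5 : T ∩ (((A ∪ B) ∪ C) ∪ D) = A ∩ T ∪ B ∩ T ∪ C ∩ T ∪ D ∩ T := by grind
  have k6 := size_add_le_card (A := T \ (((A ∪ B) ∪ C) ∪ D)) (B := ((A ∪ B) ∪ C) ∪ D) (by grind)
  rw [k5] at k4
  linarith

/-! ### Neighbourhoods -/

open Classical in
/-- The out-neighbourhood of `v`. -/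
noncomputable def outN {V : Type*} [Fintype V] (E : V → V → Prop) (v : V) : Finset V :=
  Finset.univ.filter fun w => E v w

open Classical in
/-- The in-neighbourhood of `v`. -/
noncomputable def inN {V : Type*} [Fintype V] (E : V → V → Prop) (v : V) : Finset V :=
  Finset.univ.filter fun w => E w v

@[simp] lemma mem_outN {V : Type*} [Fintype V] {E : V → V → Prop} {v w : V} :
    w ∈ outN E v ↔ E v w := by simp [outN]

@[simp] lemma mem_inN {V : Type*} [Fintype V] {E : V → V → Prop} {v w : V} :
    w ∈ inN E v ↔ E w v := by simp [inN]

lemma exists_out_le_in {V : Type*} [Fintype V] [DecidableEq V] (E : V → V → Prop)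
    {M : Finset V} (hM : M.Nonempty) :
    ∃ v ∈ M, size (M ∩ outN E v) ≤ size (M ∩ inN E v) := by
  classical
  have h := Finset.sum_card_bipartiteAbove_eq_sum_card_bipartiteBelow (s := M) (t := M) E
  obtain ⟨v, hv, hle⟩ := Finset.exists_le_of_sum_le hM h.le
  refine ⟨v, hv, ?_⟩
  have h1 : M.bipartiteAbove E v = M ∩ outN E v := by
    ext; simp [Finset.mem_bipartiteAbove]
  have h2 : M.bipartiteBelow E v = M ∩ inN E v := by
    ext; simp [Finset.mem_bipartiteBelow]
  rw [h1, h2] at hle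
  unfold size
  exact_mod_cast hle

/-- In an oriented graph without directed triangles, every nonempty set has a vertex with at most
two fifths of the set as out-neighbours inside the set. -/
lemma exists_low_outdegree {V : Type*} [Fintype V] [DecidableEq V] {E : V → V → Prop}
    (hasymm : ∀ u v, E u v → ¬ E v u)
    (htri : ∀ u v w, E u v → E v w → ¬ E w u) {M : Finset V} (hM : M.Nonempty) :
    ∃ v ∈ M, 5 * size (M ∩ outN E v) ≤ 2 * size M := by
  by_contra! hc
  obtain ⟨v, hv, hle⟩ := exists_out_le_in E hM
  have hpos : (M ∩ outN E v).Nonempty := by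
    rw [← size_pos]
    have := hc v hv
    have := size_pos.2 hM
    linarith
  obtain ⟨u, hu, hule⟩ := exists_out_le_in E hpos
  simp only [Finset.mem_inter, mem_outN] at hu
  have h1 : size (M ∩ outN E v ∩ outN E u) + size (M ∩ outN E v ∩ inN E u) ≤
      size (M ∩ outN E v) := size_inter_add_le (by
    intro z _ hz hz'
    exact hasymm _ _ (mem_outN.1 hz) (mem_inN.1 hz'))
  have h2 := hc u hu.1
  have h3 := hc v hv
  have h4 := size_inter_add_sdiff (M ∩ outN E u) (outN E v)
  have h5 : M ∩ outN E u ∩ outN E v = M ∩ outN E v ∩ outN E u := by grind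
  have h6 : size (M ∩ inN E v ∪ M ∩ outN E v) = _ := size_union_of_disjoint (by
    intro z hz hz'
    simp only [Finset.mem_inter, mem_outN, mem_inN] at hz hz'
    exact hasymm _ _ hz.2 hz'.2)
  have h7 : size ((M ∩ inN E v ∪ M ∩ outN E v) ∪ (M ∩ outN E u) \ outN E v) = _ :=
    size_union_of_disjoint (by
      intro z hz hz'
      simp only [Finset.mem_inter, Finset.mem_union, Finset.mem_sdiff, mem_outN, mem_inN]
        at hz hz'
      rcases hz with hz | hz
      · exact htri v u z hu.2 hz'.1.2 hz.2
      · exact hz'.2 hz.2)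
  have h8 : size ((M ∩ inN E v ∪ M ∩ outN E v) ∪ (M ∩ outN E u) \ outN E v) ≤ size M :=
    size_mono (by grind)
  rw [h5] at h4
  linarith

/-! ### Walks -/

/-- There is a directed walk of length `k` from `x` to `y`. -/
def Walk {V : Type*} (E : V → V → Prop) : ℕ → V → V → Prop
  | 0, x, y => x = y
  | k + 1, x, y => ∃ z, E x z ∧ Walk E k z y

lemma Walk.cons {V : Type*} {E : V → V → Prop} {k : ℕ} {x y z : V} (h : E x y)
    (h' : Walk E k y z) : Walk E (k + 1) x z := ⟨y, h, h'⟩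

lemma Walk.single {V : Type*} {E : V → V → Prop} {x y : V} (h : E x y) : Walk E 1 x y :=
  ⟨y, h, rfl⟩

lemma Walk.trans {V : Type*} {E : V → V → Prop} {j k : ℕ} {x y z : V} (h : Walk E j x y)
    (h' : Walk E k y z) : Walk E (j + k) x z := by
  induction j generalizing x with
  | zero => cases h; simpa using h'
  | succ j ih =>
    obtain ⟨w, hw, hwy⟩ := h
    rw [Nat.add_right_comm]
    exact ⟨w, hw, ih hwy⟩

lemma Walk.flip {V : Type*} {E : V → V → Prop} {k : ℕ} {x y : V} (h : Walk E k x y) :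
    Walk (fun u v => E v u) k y x := by
  induction k generalizing x with
  | zero => exact h.symm
  | succ k ih =>
    obtain ⟨w, hw, hwy⟩ := h
    exact (ih hwy).trans (Walk.single (E := fun u v => E v u) hw)

lemma Walk.mul {V : Type*} {E : V → V → Prop} {k : ℕ} {x : V} (h : Walk E k x x) (m : ℕ) :
    Walk E (m * k) x x := by
  induction m with
  | zero => rw [Nat.zero_mul]; rfl
  | succ m ih => rw [Nat.succ_mul]; exact ih.trans h

lemma Walk.exists_fun {V : Type*} {E : V → V → Prop} {k : ℕ} {x y : V} (h : Walk E k x y) :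
    ∃ w : ℕ → V, w 0 = x ∧ w k = y ∧ ∀ i < k, E (w i) (w (i + 1)) := by
  induction k generalizing x with
  | zero => exact ⟨fun _ => x, rfl, h, by simp⟩
  | succ k ih =>
    obtain ⟨z, hz, hzy⟩ := h
    obtain ⟨w, h0, hk, hw⟩ := ih hzy
    refine ⟨fun i => Nat.casesOn i x w, rfl, hk, fun i hi => ?_⟩
    cases i with
    | zero => simpa [h0] using hz
    | succ i => exact hw i (by omega)

/-! ### Oriented graphs of minimum semidegree almost a quarter without closed `ℓ`-walks -/

/-- An oriented graph with minimum semidegree at least a quarter of its order minus a small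
error `e` and without closed walks of length `ℓ`, where `ℓ ≥ 9` is divisible by `3` but not
by `4`. -/
structure Admissible {V : Type*} [Fintype V] (E : V → V → Prop) (ℓ : ℕ) (e : ℝ) : Prop where
  asymm : ∀ u v, E u v → ¬ E v u
  out_le : ∀ v, (Fintype.card V : ℝ) / 4 - e ≤ size (outN E v)
  in_le : ∀ v, (Fintype.card V : ℝ) / 4 - e ≤ size (inN E v)
  noWalk : ∀ v, ¬ Walk E ℓ v v
  nine_le : 9 ≤ ℓ
  three_dvd : 3 ∣ ℓ
  not_four_dvd : ¬ 4 ∣ ℓ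
  error_nonneg : 0 ≤ e
  error_le : 10000 * e ≤ Fintype.card V
  card_pos : (0 : ℝ) < Fintype.card V

namespace Admissible

variable {V : Type*} [Fintype V] {E : V → V → Prop} {ℓ : ℕ} {e : ℝ}

lemma flip (H : Admissible E ℓ e) : Admissible (fun u v => E v u) ℓ e where
  asymm u v h := H.asymm v u h
  out_le := H.in_le
  in_le := H.out_le
  noWalk v h := H.noWalk v h.flip
  nine_le := H.nine_le
  three_dvd := H.three_dvd
  not_four_dvd := H.not_four_dvd
  error_nonneg := H.error_nonneg
  error_le := H.error_le
  card_pos := H.card_pos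

lemma no_triangle (H : Admissible E ℓ e) (u v w : V) (h₁ : E u v) (h₂ : E v w) : ¬ E w u := by
  intro h₃
  obtain ⟨m, hm⟩ := H.three_dvd
  have : Walk E 3 u u := ((Walk.single h₃).cons h₂).cons h₁
  exact H.noWalk u (by rw [hm, Nat.mul_comm]; exact this.mul m)

lemma no_four_five (H : Admissible E ℓ e) {v : V} (h₄ : Walk E 4 v v) : ¬ Walk E 5 v v := by
  intro h₅
  obtain ⟨i, j, hij⟩ : ∃ i j, ℓ = i * 4 + j * 5 := by
    have h9 := H.nine_le
    have h3 := H.three_dvd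
    have h4 := H.not_four_dvd
    obtain h | h | h : ℓ % 12 = 9 ∨ ℓ % 12 = 3 ∨ ℓ % 12 = 6 := by omega
    · exact ⟨3 * (ℓ / 12) + 1, 1, by omega⟩
    · exact ⟨3 * (ℓ / 12 - 1), 3, by omega⟩
    · exact ⟨3 * (ℓ / 12 - 1) + 2, 2, by omega⟩
  exact H.noWalk v (hij ▸ (h₄.mul i).trans (h₅.mul j))

lemma no_five_six (H : Admissible E ℓ e) (hℓ : ℓ ≠ 9) {v : V} (h₅ : Walk E 5 v v) :
    ¬ Walk E 6 v v := by
  intro h₆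
  obtain ⟨i, j, hij⟩ : ∃ i j, ℓ = i * 5 + j * 6 := by
    have h9 := H.nine_le
    have h3 := H.three_dvd
    have h4 := H.not_four_dvd
    obtain h | h | h : ℓ % 12 = 9 ∨ ℓ % 12 = 3 ∨ ℓ % 12 = 6 := by omega
    · exact ⟨3, 2 * (ℓ / 12 - 1) + 1, by omega⟩
    · exact ⟨3, 2 * (ℓ / 12 - 1), by omega⟩
    · exact ⟨0, 2 * (ℓ / 12) + 1, by omega⟩
  exact H.noWalk v (hij ▸ (h₅.mul i).trans (h₆.mul j))

lemma no_four_six_seven (H : Admissible E ℓ e) (hℓ : ℓ ≠ 9) {v : V} (h₄ : Walk E 4 v v)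
    (h₆ : Walk E 6 v v) : ¬ Walk E 7 v v := by
  intro h₇
  obtain ⟨i, j, k, hij⟩ : ∃ i j k, ℓ = i * 4 + j * 6 + k * 7 := by
    have h9 := H.nine_le
    have h3 := H.three_dvd
    have h4 := H.not_four_dvd
    obtain h | h | h : ℓ % 12 = 9 ∨ ℓ % 12 = 3 ∨ ℓ % 12 = 6 := by omega
    · exact ⟨3 * (ℓ / 12 - 1), 0, 3, by omega⟩
    · exact ⟨3 * (ℓ / 12 - 1) + 2, 0, 1, by omega⟩
    · exact ⟨3 * (ℓ / 12), 1, 0, by omega⟩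
  exact H.noWalk v (hij ▸ ((h₄.mul i).trans (h₆.mul j)).trans (h₇.mul k))

lemma outN_nonempty (H : Admissible E ℓ e) (v : V) : (outN E v).Nonempty := by
  rw [← size_pos]
  linarith [H.out_le v, H.error_nonneg, H.error_le, H.card_pos]

lemma inN_nonempty (H : Admissible E ℓ e) (v : V) : (inN E v).Nonempty :=
  H.flip.outN_nonempty v

lemma no_short_closed (H : Admissible E ℓ e) {t : ℕ} (h1 : 1 ≤ t) (h3 : t ≤ 3) (v : V) :
    ¬ Walk E t v v := by
  intro h
  interval_cases t
  · obtain ⟨w, hw, rfl⟩ := h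
    exact H.asymm _ _ hw hw
  · obtain ⟨w, hw, u, hu, rfl⟩ := h
    exact H.asymm _ _ hw hu
  · obtain ⟨w, hw, u, hu, z, hz, rfl⟩ := h
    exact H.no_triangle _ _ _ hw hu hz

variable [DecidableEq V]

lemma exists_grow (H : Admissible E ℓ e) {M : Finset V} (hM : M.Nonempty) :
    ∃ M' : Finset V, 3 / 5 * size M + (Fintype.card V / 4 - e) ≤ size M' ∧
      ∀ z ∈ M', z ∈ M ∨ ∃ y ∈ M, E y z := by
  obtain ⟨v, hv, hlow⟩ := exists_low_outdegree H.asymm H.no_triangle hM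
  refine ⟨M ∪ outN E v \ M, ?_, ?_⟩
  · have h1 : size (M ∪ outN E v \ M) = _ := size_union_of_disjoint (by grind)
    have h2 := size_inter_add_sdiff (outN E v) M
    rw [Finset.inter_comm] at h2
    have h3 := H.out_le v
    linarith
  · intro z hz
    simp only [Finset.mem_union, Finset.mem_sdiff, mem_outN] at hz
    rcases hz with hz | hz
    · exact Or.inl hz
    · exact Or.inr ⟨v, hv, hz.1⟩

lemma exists_large_ball (H : Admissible E ℓ e) (x : V) :
    ∃ M : Finset V, (Fintype.card V : ℝ) / 2 < size M ∧
      ∀ z ∈ M, ∃ t, 1 ≤ t ∧ t ≤ 4 ∧ Walk E t x z := by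
  have key : ∀ k : ℕ, ∃ M : Finset V,
      (Fintype.card V / 4 - e) * (5 / 2 * (1 - (3 / 5) ^ (k + 1))) ≤ size M ∧
      ∀ z ∈ M, ∃ t, 1 ≤ t ∧ t ≤ k + 1 ∧ Walk E t x z := by
    intro k
    induction k with
    | zero =>
      refine ⟨outN E x, ?_, fun z hz => ⟨1, le_rfl, le_rfl, Walk.single (mem_outN.1 hz)⟩⟩
      have := H.out_le x
      norm_num
      linarith
    | succ k ih =>
      obtain ⟨M, hM, hw⟩ := ih
      have hne : M.Nonempty := by
        rw [← size_pos]
        refine lt_of_lt_of_le (mul_pos ?_ ?_) hM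
        · linarith [H.error_nonneg, H.error_le, H.card_pos]
        · have : (3 / 5 : ℝ) ^ (k + 1) < 1 := pow_lt_one₀ (by norm_num) (by norm_num) (by simp)
          linarith
      obtain ⟨M', hM', hw'⟩ := H.exists_grow hne
      refine ⟨M', ?_, fun z hz => ?_⟩
      · rw [pow_succ]
        linarith
      · rcases hw' z hz with hz | ⟨y, hy, hyz⟩
        · obtain ⟨t, h1, h2, h3⟩ := hw z hz
          exact ⟨t, h1, by omega, h3⟩
        · obtain ⟨t, h1, h2, h3⟩ := hw y hy
          exact ⟨t + 1, by omega, by omega, h3.trans (Walk.single hyz)⟩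
  obtain ⟨M, hM, hw⟩ := key 3
  refine ⟨M, lt_of_lt_of_le ?_ hM, hw⟩
  norm_num
  linarith [H.error_nonneg, H.error_le, H.card_pos]

lemma exists_walk_le_eight (H : Admissible E ℓ e) (x y : V) :
    ∃ t, 1 ≤ t ∧ t ≤ 8 ∧ Walk E t x y := by
  obtain ⟨M, hM, hMw⟩ := H.exists_large_ball x
  obtain ⟨L, hL, hLw⟩ := H.flip.exists_large_ball y
  by_contra! hc
  have := size_add_le_card (A := M) (B := L) (by
    intro z hzM hzL
    obtain ⟨s, hs, hs', hsw⟩ := hMw z hzM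
    obtain ⟨t, ht, ht', htw⟩ := hLw z hzL
    exact hc (s + t) (by omega) (by omega) (hsw.trans htw.flip))
  linarith

/-- The out-neighbourhood of a vertex induces an acyclic graph, in a strong sense. -/
lemma exists_sink (H : Admissible E ℓ e) {v : V} {A : Finset V} (hA : A.Nonempty)
    (hv : ∀ z ∈ A, E v z) : ∃ x ∈ A, ∀ y ∈ A, ¬ E x y := by
  by_contra! hc
  have key : ∀ m : ℕ, ∃ z ∈ A, ∀ j ≤ m, Walk E (j + 1) v z := by
    intro m
    induction m with
    | zero =>
      obtain ⟨z, hz⟩ := hA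
      refine ⟨z, hz, fun j hj => ?_⟩
      obtain rfl : j = 0 := by omega
      exact Walk.single (hv z hz)
    | succ m ih =>
      obtain ⟨z, hz, hw⟩ := ih
      obtain ⟨y, hy, hzy⟩ := hc z hz
      refine ⟨y, hy, fun j hj => ?_⟩
      cases j with
      | zero => exact Walk.single (hv y hy)
      | succ j => exact (hw j (by omega)).trans (Walk.single hzy)
  obtain ⟨z, -, hw⟩ := key ℓ
  obtain ⟨t, h1, h8, ht⟩ := H.exists_walk_le_eight z v
  have h9 := H.nine_le
  have := (hw (ℓ - t - 1) (by omega)).trans ht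
  exact H.noWalk v (by convert this using 1; omega)

lemma exists_source (H : Admissible E ℓ e) {v : V} {A : Finset V} (hA : A.Nonempty)
    (hv : ∀ z ∈ A, E z v) : ∃ x ∈ A, ∀ y ∈ A, ¬ E y x :=
  H.flip.exists_sink hA hv

/-- Two disjoint sets of almost half of the vertices each are joined by edges. -/
lemma exists_edge (H : Admissible E ℓ e) {M C : Finset V} (hMC : ∀ z ∈ M, z ∉ C)
    (hM : (12 : ℝ) / 25 * Fintype.card V ≤ size M) (hC : (12 : ℝ) / 25 * Fintype.card V ≤ size C) :
    ∃ x ∈ M, ∃ y ∈ C, E x y := by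
  by_contra! hc
  have hpos := H.card_pos
  obtain ⟨v, hv, hlow⟩ := exists_low_outdegree H.asymm H.no_triangle
    (size_pos.1 (lt_of_lt_of_le (by positivity) hM))
  have h1 := size_inter_add_sdiff (outN E v) M
  rw [Finset.inter_comm] at h1
  have h2 : size (M ∪ outN E v \ M) = _ := size_union_of_disjoint (by grind)
  have h3 := size_add_le_card (A := M ∪ outN E v \ M) (B := C) (by
    intro z hz
    simp only [Finset.mem_union, Finset.mem_sdiff, mem_outN] at hz
    rcases hz with hz | hz
    · exact hMC z hz
    · exact fun hzC => hc v hv z hzC hz.1)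
  have h4 := size_add_le_card hMC
  linarith [H.out_le v, H.error_nonneg, H.error_le]

/-- Almost half of all vertices are reached from `v` by a walk of length one or two. -/
lemma exists_second_outN (H : Admissible E ℓ e) (v : V) :
    ∃ M : Finset V, (12 : ℝ) / 25 * Fintype.card V ≤ size M ∧
      ∀ z ∈ M, Walk E 1 v z ∨ Walk E 2 v z := by
  obtain ⟨s, hs, hsink⟩ := H.exists_sink (H.outN_nonempty v) fun z hz => mem_outN.1 hz
  refine ⟨outN E v ∪ outN E s, ?_, fun z hz => ?_⟩
  · rw [size_union_of_disjoint fun z hz hz' => hsink z hz (mem_outN.1 hz')]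
    linarith [H.out_le v, H.out_le s, H.error_nonneg, H.error_le, H.card_pos]
  · simp only [Finset.mem_union, mem_outN] at hz hs
    rcases hz with hz | hz
    · exact Or.inl (Walk.single hz)
    · exact Or.inr ((Walk.single hz).cons hs)

lemma exists_walk_le_five (H : Admissible E ℓ e) (x y : V) :
    ∃ t, 1 ≤ t ∧ t ≤ 5 ∧ Walk E t x y := by
  obtain ⟨M, hM, hMw⟩ := H.exists_second_outN x
  obtain ⟨L, hL, hLw⟩ := H.flip.exists_second_outN y
  by_contra! hc
  obtain ⟨u, hu, v, hv, huv⟩ := H.exists_edge (M := M) (C := L) (by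
    intro z hzM hzL
    rcases hMw z hzM with h | h <;> rcases hLw z hzL with h' | h' <;>
      exact hc _ (by norm_num) (by norm_num) (h.trans h'.flip)) hM hL
  rcases hMw u hu with h | h <;> rcases hLw v hv with h' | h' <;>
    exact hc _ (by norm_num) (by norm_num) ((h.trans (Walk.single huv)).trans h'.flip)

lemma four_or_five (H : Admissible E ℓ e) (v : V) : Walk E 4 v v ∨ Walk E 5 v v := by
  obtain ⟨t, h1, h5, ht⟩ := H.exists_walk_le_five v v
  by_contra! hc
  obtain h | rfl | rfl : t ≤ 3 ∨ t = 4 ∨ t = 5 := by omega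
  · exact H.no_short_closed h1 h v ht
  · exact hc.1 ht
  · exact hc.2 ht

/-- If there are shortcuts at all, then there is a maximal one. -/
lemma exists_maximal_shortcut (H : Admissible E ℓ e) {a b c : V} (hab : E a b) (hbc : E b c)
    (hac : E a c) : ∃ a c : V, E a c ∧ (∃ b, E a b ∧ E b c) ∧ (∀ z, E a z → ¬ E c z) ∧
      ∀ z, E z a → ¬ E z c := by
  classical
  let p : ℕ → Prop := fun k => ∃ a c : V, ∀ j ≤ k, Walk E (j + 1) a c
  have hp : p 1 := ⟨a, c, fun j hj => by
    interval_cases j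
    · exact Walk.single hac
    · exact (Walk.single hbc).cons hab⟩
  have hbound : ∀ k, p k → k < ℓ := by
    rintro k ⟨a, c, hw⟩
    by_contra! hk
    obtain ⟨t, h1, h5, ht⟩ := H.exists_walk_le_five c a
    have h9 := H.nine_le
    have := (hw (ℓ - t - 1) (by omega)).trans ht
    exact H.noWalk a (by convert this using 1; omega)
  have hmax := Nat.findGreatest_spec (P := p) (hbound 1 hp).le hp
  have hle : 1 ≤ Nat.findGreatest p ℓ := Nat.le_findGreatest (hbound 1 hp).le hp
  have hnot : ¬ p (Nat.findGreatest p ℓ + 1) := fun h => by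
    have := Nat.le_findGreatest (P := p) (hbound _ h).le h
    omega
  obtain ⟨a, c, hw⟩ := hmax
  obtain ⟨c', hac', rfl⟩ := hw 0 (by omega)
  obtain ⟨b, hab, c'', hbc, rfl⟩ := hw 1 hle
  refine ⟨a, c'', hac', ⟨b, hab, hbc⟩, fun z haz hcz => hnot ?_, fun z hza hzc => hnot ?_⟩
  · refine ⟨a, z, fun j hj => ?_⟩
    cases j with
    | zero => exact Walk.single haz
    | succ j => exact (hw j (by omega)).trans (Walk.single hcz)
  · refine ⟨z, c'', fun j hj => ?_⟩
    cases j with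
    | zero => exact Walk.single hzc
    | succ j => exact (hw j (by omega)).cons hza

end Admissible

/-- A shortcut `a → b → c`, `a → c` that is maximal, together with a sink `x` of the
out-neighbourhood of `c` and a source `y` of the in-neighbourhood of `a`. -/
structure MaximalShortcut {V : Type*} (E : V → V → Prop) (a b c x y : V) : Prop where
  left : E a b
  right : E b c
  edge : E a c
  max_out : ∀ z, E a z → ¬ E c z
  max_in : ∀ z, E z a → ¬ E z c
  mem_out : E c x
  sink : ∀ z, E c z → ¬ E x z
  mem_in : E y a
  source : ∀ z, E z a → ¬ E z y
  no_three : ¬ Walk E 3 c a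

lemma MaximalShortcut.flip {V : Type*} {E : V → V → Prop} {a b c x y : V}
    (S : MaximalShortcut E a b c x y) : MaximalShortcut (fun u v => E v u) c b a y x where
  left := S.right
  right := S.left
  edge := S.edge
  max_out z h h' := S.max_in z h' h
  max_in z h h' := S.max_out z h' h
  mem_out := S.mem_in
  sink := S.source
  mem_in := S.mem_out
  source := S.sink
  no_three h := S.no_three h.flip

lemma MaximalShortcut.out_avoid {V : Type*} {E : V → V → Prop} {a b c x y u v : V}
    (S : MaximalShortcut E a b c x y) (hu : E c u) (hv : E v a) : ¬ E u v := fun h =>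
  S.no_three ⟨_, hu, _, h, _, hv, rfl⟩

namespace Admissible

variable {V : Type*} [Fintype V] {E : V → V → Prop} {ℓ : ℕ} {e : ℝ}
  {a b c x y : V}

lemma no_closed_four_left (H : Admissible E ℓ e) (S : MaximalShortcut E a b c x y)
    (h4 : Walk E 4 c a) : ¬ Walk E 4 a a := fun h =>
  H.no_four_five h (h4.cons S.edge)

lemma no_closed_four_right (H : Admissible E ℓ e) (S : MaximalShortcut E a b c x y)
    (h4 : Walk E 4 c a) : ¬ Walk E 4 c c := fun h =>
  H.no_four_five h (h4.trans (Walk.single S.edge))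

lemma no_closed_five (H : Admissible E ℓ e) {p : V} (hap : E a p) (hp : Walk E 3 p a) :
    ¬ Walk E 5 p p :=
  H.no_four_five (hp.trans (Walk.single hap))

lemma no_edge_of_walk (H : Admissible E ℓ e) {p q : V} (hap : E a p) (haq : E a q)
    (hq : Walk E 3 q a) : ¬ E p q := fun hpq =>
  H.no_four_five (hq.cons haq) ((hq.cons hpq).cons hap)

lemma no_zigzag (H : Admissible E 9 e) (S : MaximalShortcut E a b c x y) {u p v q : V}
    (hu : E c u) (hup : E u p) (hpv : E p v) (hvq : E v q) : ¬ Walk E 3 q a := fun hq =>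
  H.noWalk a ((((((hq.cons hvq).cons hpv).cons hup).cons hu).cons S.right).cons S.left)

variable [DecidableEq V]

lemma quarters_out (H : Admissible E ℓ e) (S : MaximalShortcut E a b c x y) :
    Quarters (outN E a) (outN E c) (inN E a) (inN E y) e := by
  refine Quarters.of_disjoint (H.out_le a) (H.out_le c) (H.in_le a) (H.in_le y)
    ?_ ?_ ?_ ?_ ?_ ?_ <;> simp only [mem_outN, mem_inN] <;> intro z hz hz'
  · exact S.max_out z hz hz'
  · exact H.asymm _ _ hz hz'
  · exact H.no_triangle _ _ _ hz hz' S.mem_in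
  · exact H.no_triangle _ _ _ hz hz' S.edge
  · exact S.no_three ⟨_, hz, _, hz', _, S.mem_in, rfl⟩
  · exact S.source z hz hz'

lemma quarters_in (H : Admissible E ℓ e) (S : MaximalShortcut E a b c x y) :
    Quarters (inN E c) (outN E c) (inN E a) (outN E x) e := by
  refine Quarters.of_disjoint (H.in_le c) (H.out_le c) (H.in_le a) (H.out_le x)
    ?_ ?_ ?_ ?_ ?_ ?_ <;> simp only [mem_outN, mem_inN] <;> intro z hz hz'
  · exact H.asymm _ _ hz hz'
  · exact S.max_in z hz' hz
  · exact H.no_triangle _ _ _ hz S.mem_out hz'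
  · exact H.no_triangle _ _ _ hz hz' S.edge
  · exact S.sink z hz hz'
  · exact S.no_three ⟨_, S.mem_out, _, hz', _, hz, rfl⟩

/-- A sink of a large part of the out-neighbourhood of `c` dominates most of the
out-neighbourhood of `x`. -/
lemma exists_dominating (H : Admissible E ℓ e) (S : MaximalShortcut E a b c x y)
    {N : Finset V} {k : ℝ} (hN : (Fintype.card V : ℝ) / 4 - k ≤ size (outN E c ∩ N))
    (hk : k < Fintype.card V / 4) :
    ∃ u, E c u ∧ u ∈ N ∧ (Fintype.card V : ℝ) / 4 - k - 8 * e ≤ size (outN E x ∩ outN E u) := by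
  obtain ⟨u, hu, hsink⟩ := H.exists_sink (A := outN E c ∩ N) (v := c)
    (size_pos.1 (by linarith)) (by simp +contextual)
  simp only [Finset.mem_inter, mem_outN] at hu
  refine ⟨u, hu.1, hu.2, ?_⟩
  have h1 := (H.quarters_in S).cover (outN E u)
  have h2 : size (inN E c ∩ outN E u) = 0 := size_inter_eq_zero fun z hz hz' =>
    H.no_triangle _ _ _ hu.1 (mem_outN.1 hz') (mem_inN.1 hz)
  have h3 : size (inN E a ∩ outN E u) = 0 := size_inter_eq_zero fun z hz hz' =>
    S.out_avoid hu.1 (mem_inN.1 hz) (mem_outN.1 hz')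
  have h4 : size (outN E c ∩ N) + size (outN E c ∩ outN E u) ≤ _ :=
    size_inter_add_le fun z hz hz' hz'' =>
      hsink z (Finset.mem_inter.2 ⟨hz, hz'⟩) (mem_outN.1 hz'')
  linarith [H.out_le u, (H.quarters_in S).size_B]

lemma exists_dominated (H : Admissible E ℓ e) (S : MaximalShortcut E a b c x y)
    {N : Finset V} {k : ℝ} (hN : (Fintype.card V : ℝ) / 4 - k ≤ size (inN E a ∩ N))
    (hk : k < Fintype.card V / 4) :
    ∃ u, E u a ∧ u ∈ N ∧ (Fintype.card V : ℝ) / 4 - k - 8 * e ≤ size (inN E y ∩ inN E u) :=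
  H.flip.exists_dominating S.flip hN hk

lemma lt_size_inter (H : Admissible E ℓ e) (S : MaximalShortcut E a b c x y)
    (h4 : Walk E 4 c a) : 50 * e < size (outN E x ∩ inN E y) := by
  by_contra! hc
  have hP := H.quarters_out S
  have hW := H.quarters_in S
  have h1 := hW.cover (inN E y)
  have h2 : size (outN E c ∩ inN E y) = 0 := size_inter_eq_zero fun z hz hz' =>
    S.out_avoid (mem_outN.1 hz) S.mem_in (mem_inN.1 hz')
  have h3 : size (inN E a ∩ inN E y) = 0 := size_inter_eq_zero fun z hz hz' =>
    S.source z (mem_inN.1 hz) (mem_inN.1 hz')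
  have h5 : size (outN E a ∪ outN E c) = _ := size_union_of_disjoint fun z hz hz' =>
    S.max_out z (mem_outN.1 hz) (mem_outN.1 hz')
  have h6 : size (inN E a ∪ inN E c ∩ inN E y) = _ := size_union_of_disjoint fun z hz hz' =>
    S.source z (mem_inN.1 hz) (mem_inN.1 (Finset.mem_inter.1 hz').2)
  obtain ⟨u, hu, v, hv, huv⟩ := H.exists_edge (M := outN E a ∪ outN E c)
    (C := inN E a ∪ inN E c ∩ inN E y) (by
      intro z hz hz'
      simp only [Finset.mem_union, Finset.mem_inter, mem_outN, mem_inN] at hz hz'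
      rcases hz with hz | hz <;> rcases hz' with hz' | hz'
      · exact H.asymm _ _ hz hz'
      · exact H.no_triangle _ _ _ hz hz'.2 S.mem_in
      · exact H.no_triangle _ _ _ hz hz' S.edge
      · exact H.asymm _ _ hz hz'.1)
    (by linarith [H.out_le a, H.out_le c, H.error_le, H.error_nonneg])
    (by linarith [H.in_le a, H.in_le y, H.error_le, H.error_nonneg])
  simp only [Finset.mem_union, Finset.mem_inter, mem_outN, mem_inN] at hu hv
  rcases hu with hu | hu <;> rcases hv with hv | hv
  · exact H.no_triangle _ _ _ hu huv hv
  · exact H.no_closed_four_left S h4 ⟨_, hu, _, huv, _, hv.2, _, S.mem_in, rfl⟩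
  · exact S.out_avoid hu hv huv
  · exact H.no_triangle _ _ _ hu huv hv.1

/-- The out-neighbours of an out-neighbour of `a` and `x` mostly lie in the out-neighbourhood
of `c` or in that of both `a` and `x`. -/
lemma le_size_outN_inter (H : Admissible E ℓ e) (S : MaximalShortcut E a b c x y)
    (h4 : Walk E 4 c a) {p : V} (hap : E a p) (hxp : E x p) :
    (Fintype.card V : ℝ) / 4 - 9 * e ≤
      size (outN E c ∩ outN E p) + size (outN E x ∩ (outN E a ∩ outN E p)) := by
  have h1 := (H.quarters_out S).cover (outN E p)
  have h2 := (H.quarters_in S).cover (outN E a ∩ outN E p)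
  have h3 : size (inN E a ∩ outN E p) = 0 := size_inter_eq_zero fun z hz hz' =>
    H.no_triangle _ _ _ hap (mem_outN.1 hz') (mem_inN.1 hz)
  have h5 : size (inN E y ∩ outN E p) = 0 := size_inter_eq_zero fun z hz hz' =>
    H.no_closed_four_left S h4 ⟨_, hap, _, mem_outN.1 hz', _, mem_inN.1 hz, _, S.mem_in, rfl⟩
  have h6 : size (inN E c ∩ (outN E a ∩ outN E p)) = 0 := size_inter_eq_zero fun z hz hz' =>
    H.no_closed_four_right S h4
      ⟨_, S.mem_out, _, hxp, _, mem_outN.1 (Finset.mem_inter.1 hz').2, _, mem_inN.1 hz, rfl⟩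
  have h7 : size (outN E c ∩ (outN E a ∩ outN E p)) = 0 := size_inter_eq_zero fun z hz hz' =>
    S.max_out z (mem_outN.1 (Finset.mem_inter.1 hz').1) (mem_outN.1 hz)
  have h8 : size (inN E a ∩ (outN E a ∩ outN E p)) = 0 := size_inter_eq_zero fun z hz hz' =>
    H.asymm _ _ (mem_outN.1 (Finset.mem_inter.1 hz').1) (mem_inN.1 hz)
  linarith [H.out_le p]

lemma size_outN_inter_le (H : Admissible E 9 e) (S : MaximalShortcut E a b c x y)
    (h4 : Walk E 4 c a) : size (outN E x ∩ outN E a) ≤ 20 * e := by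
  by_contra! hc
  have he := H.error_nonneg
  have hn := H.error_le
  have hpos := H.card_pos
  have hW := H.quarters_in S
  obtain ⟨p, hp, hp'⟩ := H.exists_sink (A := outN E x ∩ outN E a) (v := a)
    (size_pos.1 (by linarith)) (by simp +contextual)
  simp only [Finset.mem_inter, mem_outN, and_imp] at hp hp'
  have h1 := H.le_size_outN_inter S h4 hp.2 hp.1
  have h2 : size (outN E x ∩ (outN E a ∩ outN E p)) = 0 := size_inter_eq_zero fun z hz hz' => by
    simp only [Finset.mem_inter, mem_outN] at hz hz'
    exact hp' z hz hz'.1 hz'.2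
  obtain ⟨u, hcu, hpu, h3⟩ := H.exists_dominating S (N := outN E p) (k := 9 * e)
    (by linarith) (by linarith)
  obtain ⟨q, hq, hq'⟩ := H.exists_sink (A := outN E x ∩ outN E a ∩ outN E u) (v := a)
    (by
      obtain ⟨z, hz, hz', hz''⟩ := exists_mem_of_size_lt
        (A := outN E x) (S := outN E a) (T := outN E u) (by linarith [hW.size_D])
      exact ⟨z, by grind⟩) (by simp +contextual)
  simp only [Finset.mem_inter, mem_outN, and_imp] at hq hq'
  have h5 := H.le_size_outN_inter S h4 hq.1.2 hq.1.1
  have h6 : size (outN E x ∩ outN E u) + size (outN E x ∩ (outN E a ∩ outN E q)) ≤ _ :=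
    size_inter_add_le fun z hz hz' hz'' => by
      simp only [Finset.mem_inter, mem_outN] at hz hz' hz''
      exact hq' z hz hz''.1 hz' hz''.2
  obtain ⟨v, hcv, hqv, h7⟩ := H.exists_dominating S (N := outN E q) (k := 29 * e)
    (by linarith [hW.size_D]) (by linarith)
  obtain ⟨z, -, hz, hz'⟩ := exists_mem_of_size_lt
    (A := outN E x) (S := inN E y) (T := outN E v) (by linarith [hW.size_D, H.lt_size_inter S h4])
  simp only [mem_outN, mem_inN] at *
  exact H.noWalk c ⟨_, S.mem_out, _, hp.1, _, hpu, _, hq.2, _, hqv, _, hz', _, hz, _, S.mem_in,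
    _, S.edge, rfl⟩

lemma le_size_inN_inter (H : Admissible E 9 e) (S : MaximalShortcut E a b c x y)
    (h4 : Walk E 4 c a) : (Fintype.card V : ℝ) / 4 - 25 * e ≤ size (inN E c ∩ outN E a) := by
  have h1 := (H.quarters_in S).cover (outN E a)
  have h2 : size (outN E c ∩ outN E a) = 0 := size_inter_eq_zero fun z hz hz' =>
    S.max_out z (mem_outN.1 hz') (mem_outN.1 hz)
  have h3 : size (inN E a ∩ outN E a) = 0 := size_inter_eq_zero fun z hz hz' =>
    H.asymm _ _ (mem_outN.1 hz') (mem_inN.1 hz)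
  linarith [H.out_le a, H.size_outN_inter_le S h4]

lemma le_size_outN_inN_inter (H : Admissible E 9 e) (S : MaximalShortcut E a b c x y)
    (h4 : Walk E 4 c a) : (Fintype.card V : ℝ) / 4 - 33 * e ≤ size (outN E x ∩ inN E y) := by
  have h1 := (H.quarters_in S).cover (inN E y)
  have h2 : size (outN E c ∩ inN E y) = 0 := size_inter_eq_zero fun z hz hz' =>
    S.out_avoid (mem_outN.1 hz) S.mem_in (mem_inN.1 hz')
  have h3 : size (inN E a ∩ inN E y) = 0 := size_inter_eq_zero fun z hz hz' =>
    S.source z (mem_inN.1 hz) (mem_inN.1 hz')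
  have h5 : size (inN E c ∩ outN E a) + size (inN E c ∩ inN E y) ≤ _ :=
    size_inter_add_le fun z _ hz hz' =>
      H.no_triangle _ _ _ (mem_outN.1 hz) (mem_inN.1 hz') S.mem_in
  linarith [H.in_le y, H.le_size_inN_inter S h4, (H.quarters_in S).size_A]

lemma le_size_outN_inter_outN (H : Admissible E 9 e) (S : MaximalShortcut E a b c x y)
    (h4 : Walk E 4 c a) {p : V} (hap : E a p) (hpc : E p c) {k : ℝ} (hk : k ≤ 1000 * e)
    (hp : size (inN E c ∩ inN E p ∩ outN E a) ≤ k) :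
    (Fintype.card V : ℝ) / 4 - k - 93 * e ≤ size (outN E a ∩ outN E p) := by
  have he := H.error_nonneg
  have hn := H.error_le
  have hpos := H.card_pos
  have hP := H.quarters_out S
  have hW := H.quarters_in S
  have hZQ := H.le_size_outN_inN_inter S h4
  have h1 := hW.cover (inN E p)
  have h2 : size (outN E c ∩ inN E p) = 0 := size_inter_eq_zero fun z hz hz' =>
    H.no_triangle _ _ _ (mem_inN.1 hz') hpc (mem_outN.1 hz)
  have h3 : size (outN E x ∩ inN E p) = 0 := size_inter_eq_zero fun z hz hz' =>
    H.no_closed_four_right S h4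
      ⟨_, S.mem_out, _, mem_outN.1 hz, _, mem_inN.1 hz', _, hpc, rfl⟩
  have h5 := size_inter_add_sdiff (inN E c ∩ inN E p) (outN E a)
  have h6 := size_inter_add_sdiff (inN E c) (outN E a)
  have h7 : size ((inN E c ∩ inN E p) \ outN E a) ≤ size (inN E c \ outN E a) :=
    size_mono (by grind)
  obtain ⟨u, hua, hup, h8⟩ := H.exists_dominated S (N := inN E p) (k := k + 33 * e)
    (by linarith [H.in_le p, H.le_size_inN_inter S h4, hW.size_A]) (by linarith)
  rw [mem_inN] at hup
  have h9 := size_inter_add_inter_le (inN E y) (outN E x) (inN E u)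
  rw [Finset.inter_comm (inN E y) (outN E x)] at h9
  have hp4 : ¬ Walk E 4 p p := by
    obtain ⟨z, hz, hz'⟩ := exists_mem_of_size_inter_pos (A := outN E x) (B := inN E u)
      (by linarith [hP.size_D])
    exact fun h => H.no_four_five h ⟨_, hpc, _, S.mem_out, _, mem_outN.1 hz, _, mem_inN.1 hz', _,
      hup, rfl⟩
  have h10 : size (outN E c ∩ outN E p) ≤ k + 88 * e := by
    by_contra! hc
    obtain ⟨v, hv, hsink⟩ := H.exists_sink (A := outN E c ∩ outN E p) (v := c)
      (size_pos.1 (by linarith [size_nonneg (inN E c ∩ inN E p ∩ outN E a)]))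
      (by simp +contextual)
    simp only [Finset.mem_inter, mem_outN, and_imp] at hv hsink
    have k1 := hW.cover (outN E v)
    have k2 : size (inN E c ∩ outN E v) = 0 := size_inter_eq_zero fun z hz hz' =>
      H.no_triangle _ _ _ hv.1 (mem_outN.1 hz') (mem_inN.1 hz)
    have k3 : size (inN E a ∩ outN E v) = 0 := size_inter_eq_zero fun z hz hz' =>
      S.out_avoid hv.1 (mem_inN.1 hz) (mem_outN.1 hz')
    have k4 : size (outN E x ∩ outN E v) + size (outN E x ∩ inN E u) ≤ _ :=
      size_inter_add_le fun z _ hz hz' =>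
        hp4 ⟨_, hv.2, _, mem_outN.1 hz, _, mem_inN.1 hz', _, hup, rfl⟩
    have k5 : size (outN E c ∩ outN E v) + size (outN E c ∩ outN E p) ≤ _ :=
      size_inter_add_le fun z hz hz' hz'' =>
        hsink z (mem_outN.1 hz) (mem_outN.1 hz'') (mem_outN.1 hz')
    linarith [H.out_le v, hW.size_B, hW.size_D, hP.size_D]
  have h11 := hP.cover (outN E p)
  have h12 : size (inN E a ∩ outN E p) = 0 := size_inter_eq_zero fun z hz hz' =>
    H.no_triangle _ _ _ hap (mem_outN.1 hz') (mem_inN.1 hz)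
  have h13 : size (inN E y ∩ outN E p) = 0 := size_inter_eq_zero fun z hz hz' =>
    H.no_closed_four_left S h4 ⟨_, hap, _, mem_outN.1 hz', _, mem_inN.1 hz, _, S.mem_in, rfl⟩
  linarith [H.out_le p]

lemma exists_next (H : Admissible E 9 e) (S : MaximalShortcut E a b c x y)
    (h4 : Walk E 4 c a) {N : Finset V} {k : ℝ} (hk : k ≤ 900 * e)
    (hN : (Fintype.card V : ℝ) / 4 - k ≤ size (outN E a ∩ N)) :
    ∃ p ∈ N, E a p ∧ E p c ∧
      (Fintype.card V : ℝ) / 4 - (k + 96 * e) ≤ size (outN E a ∩ outN E p) := by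
  have he := H.error_nonneg
  have hn := H.error_le
  have hpos := H.card_pos
  have hP := H.quarters_out S
  have hne : (outN E a ∩ N ∩ inN E c).Nonempty := by
    have h1 := H.le_size_inN_inter S h4
    rw [Finset.inter_comm] at h1
    obtain ⟨z, hz, hz', hz''⟩ := exists_mem_of_size_lt (A := outN E a) (S := N) (T := inN E c)
      (by linarith [hP.size_A])
    exact ⟨z, by grind⟩
  obtain ⟨p, hp, hsource⟩ := H.exists_source hne (v := c) (by simp +contextual)
  simp only [Finset.mem_inter, mem_outN, mem_inN, and_imp] at hp hsource
  refine ⟨p, hp.1.2, hp.1.1, hp.2, ?_⟩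
  have h2 : size (outN E a ∩ N) + size (outN E a ∩ (inN E c ∩ inN E p)) ≤ _ :=
    size_inter_add_le fun z hz hz' hz'' => by
      simp only [Finset.mem_inter, mem_outN, mem_inN] at hz hz''
      exact hsource z hz hz' hz''.1 hz''.2
  rw [Finset.inter_comm (outN E a) (inN E c ∩ inN E p)] at h2
  linarith [H.le_size_outN_inter_outN S h4 hp.1.1 hp.2 (k := k + 3 * e) (by linarith)
    (by linarith [hP.size_A])]

lemma no_walk_four (H : Admissible E 9 e) (S : MaximalShortcut E a b c x y) :
    ¬ Walk E 4 c a := by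
  intro h4
  have he := H.error_nonneg
  have hn := H.error_le
  have hpos := H.card_pos
  obtain ⟨p, -, hap, -, hp⟩ := H.exists_next S h4 (N := outN E a) (k := e) (by linarith)
    (by rw [Finset.inter_self]; exact H.out_le a)
  obtain ⟨q, hpq, -, -, hq⟩ := H.exists_next S h4 (by linarith) hp
  obtain ⟨r, hqr, -, -, hr⟩ := H.exists_next S h4 (by linarith) hq
  obtain ⟨s, hrs, -, hsc, -⟩ := H.exists_next S h4 (by linarith) hr
  obtain ⟨z, hz, hz'⟩ := exists_mem_of_size_inter_pos (A := outN E x) (B := inN E y)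
    (by linarith [H.lt_size_inter S h4])
  rw [mem_outN] at hpq hqr hrs hz
  exact H.noWalk a ⟨_, hap, _, hpq, _, hqr, _, hrs, _, hsc, _, S.mem_out, _, hz, _,
    mem_inN.1 hz', _, S.mem_in, rfl⟩

lemma exists_dominating_left (H : Admissible E ℓ e) (S : MaximalShortcut E a b c x y)
    (h4 : ¬ Walk E 4 c a) {N : Finset V} {k : ℝ}
    (hN : (Fintype.card V : ℝ) / 4 - k ≤ size (outN E c ∩ N)) (hk : k < Fintype.card V / 4) :
    ∃ u, E c u ∧ u ∈ N ∧ (Fintype.card V : ℝ) / 4 - k - 8 * e ≤ size (outN E a ∩ outN E u) := by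
  obtain ⟨u, hu, hsink⟩ := H.exists_sink (A := outN E c ∩ N) (v := c)
    (size_pos.1 (by linarith)) (by simp +contextual)
  simp only [Finset.mem_inter, mem_outN] at hu
  refine ⟨u, hu.1, hu.2, ?_⟩
  have h1 := (H.quarters_out S).cover (outN E u)
  have h2 : size (inN E y ∩ outN E u) = 0 := size_inter_eq_zero fun z hz hz' =>
    h4 ⟨_, hu.1, _, mem_outN.1 hz', _, mem_inN.1 hz, _, S.mem_in, rfl⟩
  have h3 : size (inN E a ∩ outN E u) = 0 := size_inter_eq_zero fun z hz hz' =>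
    S.out_avoid hu.1 (mem_inN.1 hz) (mem_outN.1 hz')
  have h4 : size (outN E c ∩ N) + size (outN E c ∩ outN E u) ≤ _ :=
    size_inter_add_le fun z hz hz' hz'' =>
      hsink z (Finset.mem_inter.2 ⟨hz, hz'⟩) (mem_outN.1 hz'')
  linarith [H.out_le u, (H.quarters_out S).size_B]

lemma lt_size_inter_walk (H : Admissible E ℓ e) (S : MaximalShortcut E a b c x y)
    (h4 : ¬ Walk E 4 c a) : 50 * e < size (outN E a ∩ inN (Walk E 3) a) := by
  by_contra! hc
  have h1 := size_inter_add_sdiff (outN E a) (inN (Walk E 3) a)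
  have h2 : size (outN E a \ inN (Walk E 3) a ∪ outN E c) = _ :=
    size_union_of_disjoint fun z hz hz' =>
      S.max_out z (mem_outN.1 (Finset.mem_sdiff.1 hz).1) (mem_outN.1 hz')
  have h3 : size (inN E a ∪ inN E y) = _ := size_union_of_disjoint fun z hz hz' =>
    S.source z (mem_inN.1 hz) (mem_inN.1 hz')
  obtain ⟨u, hu, v, hv, huv⟩ := H.exists_edge (M := outN E a \ inN (Walk E 3) a ∪ outN E c)
    (C := inN E a ∪ inN E y) (by
      intro z hz hz'
      simp only [Finset.mem_union, Finset.mem_sdiff, mem_outN, mem_inN] at hz hz'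
      rcases hz with hz | hz <;> rcases hz' with hz' | hz'
      · exact H.asymm _ _ hz.1 hz'
      · exact H.no_triangle _ _ _ hz.1 hz' S.mem_in
      · exact H.no_triangle _ _ _ hz hz' S.edge
      · exact S.no_three ⟨_, hz, _, hz', _, S.mem_in, rfl⟩)
    (by linarith [H.out_le a, H.out_le c, H.error_le, H.error_nonneg])
    (by linarith [H.in_le a, H.in_le y, H.error_le, H.error_nonneg])
  simp only [Finset.mem_union, Finset.mem_sdiff, mem_outN, mem_inN] at hu hv
  rcases hu with hu | hu <;> rcases hv with hv | hv
  · exact H.no_triangle _ _ _ hu.1 huv hv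
  · exact hu.2 ⟨_, huv, _, hv, _, S.mem_in, rfl⟩
  · exact S.out_avoid hu hv huv
  · exact h4 ⟨_, hu, _, huv, _, hv, _, S.mem_in, rfl⟩

lemma le_size_outN_inter_left (H : Admissible E ℓ e) (S : MaximalShortcut E a b c x y)
    (h4 : ¬ Walk E 4 c a) :
    (Fintype.card V : ℝ) / 4 - 5 * e ≤ size (outN E a ∩ outN E x) := by
  have h1 := (H.quarters_out S).cover (outN E x)
  have h2 : size (outN E c ∩ outN E x) = 0 := size_inter_eq_zero fun z hz hz' =>
    S.sink z (mem_outN.1 hz) (mem_outN.1 hz')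
  have h3 : size (inN E a ∩ outN E x) = 0 := size_inter_eq_zero fun z hz hz' =>
    S.out_avoid S.mem_out (mem_inN.1 hz) (mem_outN.1 hz')
  have h5 : size (inN E y ∩ outN E x) = 0 := size_inter_eq_zero fun z hz hz' =>
    h4 ⟨_, S.mem_out, _, mem_outN.1 hz', _, mem_inN.1 hz, _, S.mem_in, rfl⟩
  linarith [H.out_le x]

lemma walk_three (H : Admissible E 9 e) (S : MaximalShortcut E a b c x y)
    (h4 : ¬ Walk E 4 c a) {p : V} (hap : E a p) (hxp : E x p) : Walk E 3 p a := by
  by_contra hp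
  have he := H.error_nonneg
  have hn := H.error_le
  have hpos := H.card_pos
  have hP := H.quarters_out S
  obtain ⟨q, hq, hsink⟩ := H.exists_sink (A := (outN E a ∩ outN E x) \ inN (Walk E 3) a) (v := a)
    ⟨p, by simp [hap, hxp, hp]⟩ (by simp +contextual)
  simp only [Finset.mem_inter, Finset.mem_sdiff, mem_outN, mem_inN, and_imp] at hq hsink
  have h1 := hP.cover (outN E q)
  have h2 : size (inN E a ∩ outN E q) = 0 := size_inter_eq_zero fun z hz hz' =>
    H.no_triangle _ _ _ hq.1.1 (mem_outN.1 hz') (mem_inN.1 hz)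
  have h3 : size (inN E y ∩ outN E q) = 0 := size_inter_eq_zero fun z hz hz' =>
    hq.2 ⟨_, mem_outN.1 hz', _, mem_inN.1 hz, _, S.mem_in, rfl⟩
  have h5 : size (outN E a ∩ outN E x) + size (outN E a ∩ outN E q) ≤ _ :=
    size_inter_add_le fun z hz hz' hz'' => by
      rw [mem_outN] at hz hz' hz''
      exact hsink z hz hz' (fun h => H.no_edge_of_walk hq.1.1 hz h hz'') hz''
  obtain ⟨v, hcv, hqv, h6⟩ := H.exists_dominating_left S h4 (N := outN E q) (k := 13 * e)
    (by linarith [H.out_le q, H.le_size_outN_inter_left S h4, hP.size_A]) (by linarith)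
  obtain ⟨z, -, hz, hz'⟩ := exists_mem_of_size_lt (A := outN E a) (S := inN (Walk E 3) a)
    (T := outN E v) (by linarith [hP.size_A, H.lt_size_inter_walk S h4])
  rw [mem_outN] at hqv hz'
  exact H.no_zigzag S S.mem_out hq.1.2 hqv hz' (mem_inN.1 hz)

lemma le_size_inter_walk (H : Admissible E 9 e) (S : MaximalShortcut E a b c x y)
    (h4 : ¬ Walk E 4 c a) :
    (Fintype.card V : ℝ) / 4 - 5 * e ≤ size (outN E a ∩ inN (Walk E 3) a) := by
  refine (H.le_size_outN_inter_left S h4).trans (size_mono fun z hz => ?_)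
  simp only [Finset.mem_inter, mem_outN, mem_inN] at hz ⊢
  exact ⟨hz.1, H.walk_three S h4 hz.1 hz.2⟩

lemma size_outN_inter_outN_le (H : Admissible E 9 e) (S : MaximalShortcut E a b c x y)
    (h4 : ¬ Walk E 4 c a) {p : V} (hap : E a p) : size (outN E a ∩ outN E p) ≤ 8 * e := by
  have h1 : size (outN E a ∩ outN E p) + size (outN E a ∩ inN (Walk E 3) a) ≤ _ :=
    size_inter_add_le fun z hz hz' hz'' =>
      H.no_edge_of_walk hap (mem_outN.1 hz) (mem_inN.1 hz'') (mem_outN.1 hz')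
  linarith [H.le_size_inter_walk S h4, (H.quarters_out S).size_A]

lemma le_size_inN_inter_outN (H : Admissible E 9 e) (S : MaximalShortcut E a b c x y)
    (h4 : ¬ Walk E 4 c a) {u p : V} (hcu : E c u) (hup : E u p) (hap : E a p) :
    (Fintype.card V : ℝ) / 4 - 29 * e ≤ size (inN E y ∩ outN E p) := by
  have he := H.error_nonneg
  have hP := H.quarters_out S
  have h1 : size (outN E c ∩ outN E p) ≤ 16 * e := by
    by_contra! hc
    obtain ⟨v, hv, hsink⟩ := H.exists_sink (A := outN E c ∩ outN E p) (v := c)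
      (size_pos.1 (by linarith)) (by simp +contextual)
    simp only [Finset.mem_inter, mem_outN, and_imp] at hv hsink
    have k1 := hP.cover (outN E v)
    have k2 : size (inN E a ∩ outN E v) = 0 := size_inter_eq_zero fun z hz hz' =>
      S.out_avoid hv.1 (mem_inN.1 hz) (mem_outN.1 hz')
    have k3 : size (inN E y ∩ outN E v) = 0 := size_inter_eq_zero fun z hz hz' =>
      h4 ⟨_, hv.1, _, mem_outN.1 hz', _, mem_inN.1 hz, _, S.mem_in, rfl⟩
    have k4 : size (outN E a ∩ outN E v) + size (outN E a ∩ inN (Walk E 3) a) ≤ _ :=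
      size_inter_add_le fun z _ hz hz' =>
        H.no_zigzag S hcu hup hv.2 (mem_outN.1 hz) (mem_inN.1 hz')
    have k5 : size (outN E c ∩ outN E v) + size (outN E c ∩ outN E p) ≤ _ :=
      size_inter_add_le fun z hz hz' hz'' =>
        hsink z (mem_outN.1 hz) (mem_outN.1 hz'') (mem_outN.1 hz')
    linarith [H.out_le v, H.le_size_inter_walk S h4, hP.size_A, hP.size_B]
  have h2 := hP.cover (outN E p)
  have h3 : size (inN E a ∩ outN E p) = 0 := size_inter_eq_zero fun z hz hz' =>
    H.no_triangle _ _ _ hap (mem_outN.1 hz') (mem_inN.1 hz)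
  linarith [H.out_le p, H.size_outN_inter_outN_le S h4 hap]

lemma no_dominating_pair (H : Admissible E 9 e) (S : MaximalShortcut E a b c x y)
    (h4 : ¬ Walk E 4 c a) {u v : V} (hcv : E c v) (hbv : E b v) (hub : E u b)
    (hv : (Fintype.card V : ℝ) / 4 - 100 * e ≤ size (outN E a ∩ outN E v)) :
    size (inN E y ∩ inN E u) < (Fintype.card V : ℝ) / 4 - 100 * e := by
  by_contra! hu
  have he := H.error_nonneg
  have hn := H.error_le
  have hpos := H.card_pos
  have hP := H.quarters_out S
  obtain ⟨p, hp, hp', hp''⟩ := exists_mem_of_size_lt (A := outN E a) (S := inN (Walk E 3) a)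
    (T := outN E v) (by linarith [hP.size_A, H.le_size_inter_walk S h4])
  rw [mem_outN] at hp hp''
  obtain ⟨q, -, hq, hq'⟩ := exists_mem_of_size_lt (A := inN E y) (S := outN E p)
    (T := inN E u) (by linarith [hP.size_D, H.le_size_inN_inter_outN S h4 hcv hp'' hp])
  exact H.no_closed_five hp (mem_inN.1 hp')
    ⟨_, mem_outN.1 hq, _, mem_inN.1 hq', _, hub, _, hbv, _, hp'', rfl⟩

lemma walk_four (H : Admissible E 9 e) (S : MaximalShortcut E a b c x y) : Walk E 4 c a := by
  by_contra h4
  have he := H.error_nonneg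
  have hn := H.error_le
  have hpos := H.card_pos
  have hP := H.quarters_out S
  obtain ⟨p, hap, hxp⟩ := exists_mem_of_size_inter_pos (A := outN E a) (B := outN E x)
    (by linarith [H.le_size_outN_inter_left S h4])
  rw [mem_outN] at hap hxp
  have h1 := hP.cover (inN E b)
  have h2 : size (outN E c ∩ inN E b) = 0 := size_inter_eq_zero fun z hz hz' =>
    H.no_triangle _ _ _ S.right (mem_outN.1 hz) (mem_inN.1 hz')
  have h3 : size (inN E y ∩ inN E b) + size (inN E y ∩ outN E p) ≤ _ :=
    size_inter_add_le fun z _ hz hz' =>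
      H.no_closed_five hap (H.walk_three S h4 hap hxp)
        ⟨_, mem_outN.1 hz', _, mem_inN.1 hz, _, S.right, _, S.mem_out, _, hxp, rfl⟩
  have h5 := hP.cover (outN E b)
  have h6 : size (inN E a ∩ outN E b) = 0 := size_inter_eq_zero fun z hz hz' =>
    H.no_triangle _ _ _ S.left (mem_outN.1 hz') (mem_inN.1 hz)
  have h7 := H.le_size_inN_inter_outN S h4 S.mem_out hxp hap
  have h8 := H.size_outN_inter_outN_le S h4 S.left
  by_cases hb : ∃ q, E b q ∧ E q y
  · obtain ⟨q, hbq, hqy⟩ := hb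
    have k1 : size (outN E a ∩ inN E b) = 0 := size_inter_eq_zero fun z hz hz' =>
      H.no_edge_of_walk (mem_outN.1 hz) S.left ⟨_, hbq, _, hqy, _, S.mem_in, rfl⟩
        (mem_inN.1 hz')
    obtain ⟨u, -, hub, k2⟩ := H.exists_dominated S (N := inN E b) (k := 37 * e)
      (by linarith [H.in_le b, hP.size_D]) (by linarith)
    rw [mem_inN] at hub
    have k3 : size (inN E y ∩ outN E b) + size (inN E y ∩ inN E u) ≤ _ :=
      size_inter_add_le fun z _ hz hz' =>
        H.no_triangle _ _ _ hub (mem_outN.1 hz) (mem_inN.1 hz')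
    obtain ⟨v, hcv, hbv, k4⟩ := H.exists_dominating_left S h4 (N := outN E b) (k := 61 * e)
      (by linarith [H.out_le b, hP.size_D]) (by linarith)
    linarith [H.no_dominating_pair S h4 hcv (mem_outN.1 hbv) hub (by linarith)]
  · push Not at hb
    have k1 : size (inN E y ∩ outN E b) = 0 := size_inter_eq_zero fun z hz hz' =>
      hb z (mem_outN.1 hz') (mem_inN.1 hz)
    obtain ⟨v, hcv, hbv, k2⟩ := H.exists_dominating_left S h4 (N := outN E b) (k := 13 * e)
      (by linarith [H.out_le b]) (by linarith)
    rw [mem_outN] at hbv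
    have k3 : size (outN E a ∩ inN E b) + size (outN E a ∩ outN E v) ≤ _ :=
      size_inter_add_le fun z _ hz hz' =>
        H.no_triangle _ _ _ hbv (mem_outN.1 hz') (mem_inN.1 hz)
    obtain ⟨u, -, hub, k4⟩ := H.exists_dominated S (N := inN E b) (k := 61 * e)
      (by linarith [H.in_le b, hP.size_D, hP.size_A]) (by linarith)
    linarith [H.no_dominating_pair S h4 hcv hbv (mem_inN.1 hub) (by linarith)]

lemma no_shortcut (H : Admissible E ℓ e) {a b c : V} (hab : E a b) (hbc : E b c) : ¬ E a c := by
  intro hac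
  obtain ⟨a, c, hac, ⟨b, hab, hbc⟩, hout, hin⟩ := H.exists_maximal_shortcut hab hbc hac
  have h3 : ¬ Walk E 3 c a := fun h => H.no_four_five (h.cons hac) ((h.cons hbc).cons hab)
  by_cases hℓ : ℓ = 9
  · subst hℓ
    obtain ⟨x, hx, hx'⟩ := H.exists_sink (H.outN_nonempty c) fun z hz => mem_outN.1 hz
    obtain ⟨y, hy, hy'⟩ := H.exists_source (H.inN_nonempty a) fun z hz => mem_inN.1 hz
    have S : MaximalShortcut E a b c x y :=
      { left := hab
        right := hbc
        edge := hac
        max_out := hout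
        max_in := hin
        mem_out := mem_outN.1 hx
        sink := fun z hz => hx' z (mem_outN.2 hz)
        mem_in := mem_inN.1 hy
        source := fun z hz => hy' z (mem_inN.2 hz)
        no_three := h3 }
    exact H.no_walk_four S (H.walk_four S)
  · obtain ⟨t, h1, h5, ht⟩ := H.exists_walk_le_five c a
    have hs := ht.cons hac
    have hl := (ht.cons hbc).cons hab
    obtain h | rfl | rfl | rfl : t ≤ 2 ∨ t = 3 ∨ t = 4 ∨ t = 5 := by omega
    · exact H.no_short_closed (by omega) (by omega) a hs
    · exact h3 ht
    · exact H.no_five_six hℓ hs hl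
    · rcases H.four_or_five a with h | h
      · exact H.no_four_six_seven hℓ h hs hl
      · exact H.no_five_six hℓ h hs

/-- The underlying undirected graph is bipartite. -/
lemma exists_bipartition (H : Admissible E ℓ e) : ∃ f : V → Bool, ∀ u v, E u v → f u ≠ f v := by
  classical
  let G : SimpleGraph V :=
    { Adj := fun u v => E u v ∨ E v u
      symm := ⟨fun u v h => h.symm⟩
      loopless := ⟨fun u h => h.elim (fun h => H.asymm _ _ h h) fun h => H.asymm _ _ h h⟩ }
  have hfree : G.CliqueFree 3 := by
    intro s hs
    obtain ⟨u, v, w, huv, huw, hvw, -⟩ := SimpleGraph.is3Clique_iff.1 hs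
    rcases huv with h | h <;> rcases huw with h' | h' <;> rcases hvw with h'' | h''
    · exact H.no_shortcut h h'' h'
    · exact H.no_shortcut h' h'' h
    · exact H.no_triangle _ _ _ h h'' h'
    · exact H.no_shortcut h' h h''
    · exact H.no_shortcut h h' h''
    · exact H.no_triangle _ _ _ h h' h''
    · exact H.no_shortcut h'' h' h
    · exact H.no_shortcut h'' h h'
  have hV : Nonempty V := Fintype.card_pos_iff.1 (by exact_mod_cast H.card_pos)
  have hdeg : (3 * 2 - 4) * Fintype.card V / (3 * 2 - 1) < G.minDegree := by
    refine lt_of_lt_of_le ?_ (G.le_minDegree_of_forall_le_degree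
      (2 * Fintype.card V / 5 + 1) fun v => ?_)
    · simp
    · have h1 : size (outN E v ∪ inN E v) = _ := size_union_of_disjoint fun z hz hz' =>
        H.asymm _ _ (mem_outN.1 hz) (mem_inN.1 hz')
      have h2 : outN E v ∪ inN E v = G.neighborFinset v := by
        ext z
        simp [G]
      rw [h2, size, SimpleGraph.card_neighborFinset_eq_degree] at h1
      have h3 : (2 * Fintype.card V : ℝ) < 5 * G.degree v := by
        linarith [H.out_le v, H.in_le v, H.error_nonneg, H.error_le, H.card_pos]
      have h4 : 2 * Fintype.card V < 5 * G.degree v := by exact_mod_cast h3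
      omega
  obtain ⟨f⟩ := SimpleGraph.colorable_of_cliqueFree_lt_minDegree hfree hdeg
  refine ⟨fun v => f v = 0, fun u v huv hf => f.valid (v := u) (w := v) (Or.inl huv) ?_⟩
  rw [decide_eq_decide] at hf
  omega

end Admissible

/-- For `ℓ ≥ 9` divisible by `3` but not by `4`: for every `ε > 0` there exist `δ > 0`
and `n₀` such that every oriented graph on `n ≥ n₀` vertices with minimum semidegree at
least `n/4 - δn` and no closed directed walk of length `ℓ` can be made bipartite by
removing at most `εn` vertices. -/
theorem almost_bipartite_of_no_closed_walk (ℓ : ℕ) (hℓ : 9 ≤ ℓ) (h3 : 3 ∣ ℓ) (h4 : ¬ 4 ∣ ℓ) :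
    ∀ ε : ℝ, 0 < ε → ∃ δ : ℝ, 0 < δ ∧ ∃ n₀ : ℕ, ∀ n : ℕ, n₀ ≤ n →
      ∀ E : Fin n → Fin n → Prop, Oriented E →
      (∀ v, (n : ℝ) / 4 - δ * n ≤ (semiDeg E v : ℝ)) →
      ¬ HasClosedWalk E ℓ →
      ∃ S : Finset (Fin n), (S.card : ℝ) ≤ ε * n ∧
        ∃ f : Fin n → Bool, ∀ u v : Fin n, u ∉ S → v ∉ S → E u v → f u ≠ f v := by
  intro ε hε
  refine ⟨1 / 10000, by norm_num, 1, fun n hn E hE hdeg hwalk => ?_⟩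
  have hn' : (0 : ℝ) < n := by exact_mod_cast hn
  have hout : ∀ v, (outDeg E v : ℝ) = size (outN E v) := fun v => by
    rw [outDeg, size, ← Set.ncard_coe_finset]
    congr 2
    ext
    simp
  have hin : ∀ v, (inDeg E v : ℝ) = size (inN E v) := fun v => by
    rw [inDeg, size, ← Set.ncard_coe_finset]
    congr 2
    ext
    simp
  have hle : ∀ v, (semiDeg E v : ℝ) ≤ size (outN E v) ∧ (semiDeg E v : ℝ) ≤ size (inN E v) :=
    fun v => by
      rw [← hout, ← hin]
      exact ⟨by exact_mod_cast min_le_left _ _, by exact_mod_cast min_le_right _ _⟩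
  have H : Admissible E ℓ (1 / 10000 * n) :=
    { asymm := hE.2
      out_le := fun v => by
        rw [Fintype.card_fin]
        exact (hdeg v).trans (hle v).1
      in_le := fun v => by
        rw [Fintype.card_fin]
        exact (hdeg v).trans (hle v).2
      noWalk := fun v h => by
        obtain ⟨w, h0, hw, hE⟩ := h.exists_fun
        exact hwalk ⟨w, h0.trans hw.symm, hE⟩
      nine_le := hℓ
      three_dvd := h3
      not_four_dvd := h4
      error_nonneg := by positivity
      error_le := by
        rw [Fintype.card_fin]
        linarith
      card_pos := by rwa [Fintype.card_fin] }
  obtain ⟨f, hf⟩ := H.exists_bipartition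
  exact ⟨∅, by simpa using by positivity, f, fun u v _ _ huv => hf u v huv⟩
end

section
/- Let ℓ ≥ 4 be an integer and let k be the smallest integer greater than 2 that does not divide ℓ; assume k ≥ 5. Let A₁, …, A_m be finite sets of non-zero elements of ℤ/kℤ, let B_i = A_i ∪ {0} for each i, and let S = B₁ + B₂ + ⋯ + B_m be their pointwise sumset (so S is the set of all values obtainable by summing, for each i, either 0 or one element of A_i). Then either the residue of ℓ modulo k belongs to S, or S contains at least |A₁| + |A₂| + ⋯ + |A_m| distinct non-zero elements of ℤ/kℤ. -/
open Pointwise in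
/-- Two finite sets containing `0` satisfy the Cauchy-Davenport bound as soon as their sumset
misses an element lying in every nontrivial cyclic submonoid. -/
theorem Finset.card_add_card_le_of_notMem_add {G : Type*} [AddCommGroup G] [DecidableEq G]
    {g : G} (hg : ∀ b : G, b ≠ 0 → ∃ n : ℕ, n • b = g) (A B : Finset G)
    (hA : 0 ∈ A) (hB : 0 ∈ B) (hgAB : g ∉ A + B) :
    A.card + B.card ≤ (A + B).card + 1 := by
  induction hn : B.card using Nat.strong_induction_on generalizing A B with
  | _ n ih =>
  subst hn
  by_cases hstable : ∀ e ∈ A, ∀ b ∈ B, e + b ∈ A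
  · have hB0 : B = {0} := by
      refine Finset.eq_singleton_iff_unique_mem.2 ⟨hB, fun b hb => ?_⟩
      by_contra hb0
      obtain ⟨n, rfl⟩ := hg b hb0
      have hmul : ∀ j : ℕ, j • b ∈ A := by
        intro j
        induction j with
        | zero => simpa using hA
        | succ j hj => simpa [succ_nsmul] using hstable _ hj b hb
      exact hgAB (by simpa using Finset.add_mem_add (hmul n) hB)
    simp [hB0]
  · push Not at hstable
    obtain ⟨e, he, b, hb, hbA⟩ := hstable
    -- the Dyson transform of `(A, B)` at `e`
    have hsub : (A ∪ (e +ᵥ B)) + (B ∩ (-e +ᵥ A)) ⊆ A + B := by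
      simpa [addDysonETransform] using addDysonETransform.subset e (A, B)
    have hcard : (A ∪ (e +ᵥ B)).card + (B ∩ (-e +ᵥ A)).card = A.card + B.card := by
      simpa [addDysonETransform] using addDysonETransform.card e (A, B)
    have hlt : (B ∩ (-e +ᵥ A)).card < B.card := by
      refine Finset.card_lt_card (Finset.ssubset_iff_subset_ne.2
        ⟨Finset.inter_subset_left, fun h => hbA ?_⟩)
      have hb' := (Finset.mem_inter.1 (h.symm ▸ hb)).2
      simpa [Finset.mem_neg_vadd_finset_iff] using hb'
    have h0 : (0 : G) ∈ B ∩ (-e +ᵥ A) := by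
      simp [Finset.mem_neg_vadd_finset_iff, hB, he]
    have := ih _ hlt _ _ (Finset.mem_union_left _ hA) h0 (fun h => hgAB (hsub h)) rfl
    have := Finset.card_le_card hsub
    omega

open Pointwise in
/-- The iterated form of `Finset.card_add_card_le_of_notMem_add`. -/
theorem Finset.sum_card_lt_card_sum_insert_zero {ι G : Type*} [AddCommGroup G] [DecidableEq G]
    {g : G} (hg : ∀ b : G, b ≠ 0 → ∃ n : ℕ, n • b = g) (s : Finset ι) (A : ι → Finset G)
    (hA : ∀ i ∈ s, (0 : G) ∉ A i) (hgs : g ∉ ∑ i ∈ s, insert (0 : G) (A i)) :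
    (0 : G) ∈ ∑ i ∈ s, insert (0 : G) (A i) ∧
      ∑ i ∈ s, (A i).card < (∑ i ∈ s, insert (0 : G) (A i)).card := by
  classical
  induction s using Finset.induction_on with
  | empty => simp
  | insert a s ha ih =>
    rw [Finset.sum_insert ha] at hgs ⊢
    rw [Finset.sum_insert ha]
    have h0a : (0 : G) ∈ insert (0 : G) (A a) := Finset.mem_insert_self _ _
    obtain ⟨h0, hlt⟩ := ih (fun i hi => hA i (Finset.mem_insert_of_mem hi))
      (fun h => hgs (by simpa using Finset.add_mem_add h0a h))
    refine ⟨by simpa using Finset.add_mem_add h0a h0, ?_⟩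
    have hle := Finset.card_add_card_le_of_notMem_add hg _ _ h0a h0 hgs
    rw [Finset.card_insert_of_notMem (hA a (Finset.mem_insert_self _ _))] at hle
    omega

/-- If every proper divisor of `k` divides `ℓ`, then `ℓ` is a multiple of every nonzero element of
`ZMod k`. -/
theorem ZMod.exists_nsmul_eq_natCast {ℓ k : ℕ} [NeZero k] (h : ∀ d, d ∣ k → d < k → d ∣ ℓ)
    (b : ZMod k) (hb : b ≠ 0) : ∃ n : ℕ, n • b = (ℓ : ZMod k) := by
  have hpos : 0 < b.val := Nat.pos_of_ne_zero (by simpa using hb)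
  obtain ⟨c, hc⟩ := h (b.val.gcd k) (Nat.gcd_dvd_right _ _)
    ((Nat.gcd_le_left _ hpos).trans_lt b.val_lt)
  have hbez := congrArg (Int.cast : ℤ → ZMod k) (Nat.gcd_eq_gcd_ab b.val k)
  push_cast at hbez
  rw [ZMod.natCast_self, zero_mul, add_zero, ZMod.natCast_zmod_val] at hbez
  refine ⟨((Nat.gcdA b.val k : ZMod k) * c).val, ?_⟩
  rw [nsmul_eq_mul, ZMod.natCast_zmod_val, hc, Nat.cast_mul, hbez]
  ring

open Pointwise in
/-- Let `ℓ ≥ 4`, let `k ≥ 5` be the smallest integer greater than `2` not dividing `ℓ`,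
and let `A₁, …, A_m` be sets of non-zero elements of `ℤ/kℤ`. Setting `Bᵢ = Aᵢ ∪ {0}` and
`S = B₁ + ⋯ + B_m` (pointwise sumset), either `ℓ mod k ∈ S` or `S` contains at least
`|A₁| + ⋯ + |A_m|` distinct non-zero elements. -/
theorem kneser_sidewalk_lemma (ℓ k : ℕ) (hℓ : 4 ≤ ℓ)
    (hk2 : 2 < k) (hkd : ¬ k ∣ ℓ) (hkmin : ∀ m : ℕ, 2 < m → ¬ m ∣ ℓ → k ≤ m) (hk5 : 5 ≤ k)
    (m : ℕ) (A : Fin m → Finset (ZMod k)) (hA : ∀ i, (0 : ZMod k) ∉ A i) :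
    ((ℓ : ZMod k) ∈ ∑ i : Fin m, insert (0 : ZMod k) (A i)) ∨
      (∑ i : Fin m, (A i).card) ≤
        ((∑ i : Fin m, insert (0 : ZMod k) (A i)).filter (fun x => x ≠ 0)).card := by
  have : NeZero k := ⟨by omega⟩
  have hdvd : ∀ d, d ∣ k → d < k → d ∣ ℓ := by
    intro d hd hdk
    by_cases h2 : 2 < d
    · by_contra h
      exact absurd (hkmin d h2 h) (by omega)
    · have h4 : 4 ∣ ℓ := by
        by_contra h
        exact absurd (hkmin 4 (by omega) h) (by omega)
      have hd0 : 0 < d := Nat.pos_of_dvd_of_pos hd (by omega)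
      interval_cases d <;> omega
  refine or_iff_not_imp_left.2 fun hS => ?_
  obtain ⟨h0, hlt⟩ := Finset.sum_card_lt_card_sum_insert_zero
    (ZMod.exists_nsmul_eq_natCast hdvd) Finset.univ A (fun i _ => hA i) hS
  rw [Finset.filter_ne', Finset.card_erase_of_mem h0]
  omega
end

section
/- Fix an integer ℓ ≥ 18 that is divisible by 6 and not divisible by 12. There exist ε > 0 and n₀ such that every oriented graph H on n ≥ n₀ vertices with minimum semidegree δ±(H) ≥ n/4 − ε·n that contains no closed directed walk of length ℓ is homomorphic to the directed cycle C₄. -/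
namespace ClosedWalks

variable {V : Type*}

/-- `Walk E k x y`: there is a directed walk of length exactly `k` from `x` to `y`. -/
def Walk (E : V → V → Prop) : ℕ → V → V → Prop
  | 0, x, y => x = y
  | k + 1, x, y => ∃ z, Walk E k x z ∧ E z y

theorem walk_one {E : V → V → Prop} {x y : V} : Walk E 1 x y ↔ E x y := by
  simp [Walk]

theorem Walk.trans {E : V → V → Prop} {a b : ℕ} {x y z : V} (h : Walk E a x y)
    (h' : Walk E b y z) : Walk E (a + b) x z := by
  induction b generalizing z with
  | zero => obtain rfl : y = z := h'; exact h
  | succ b ih => obtain ⟨u, hu, huz⟩ := h'; exact ⟨u, ih hu, huz⟩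

theorem Walk.cast {E : V → V → Prop} {a b : ℕ} {x y : V} (h : Walk E a x y) (hab : a = b) :
    Walk E b x y := hab ▸ h

theorem Walk.iterate {E : V → V → Prop} {a : ℕ} {x : V} (h : Walk E a x x) (m : ℕ) :
    Walk E (m * a) x x := by
  induction m with
  | zero => exact Walk.cast (a := 0) rfl (by simp)
  | succ m ih => exact (ih.trans h).cast (by ring)

theorem Walk.reverse {E : V → V → Prop} {k : ℕ} {x y : V} (h : Walk E k x y) :
    Walk (flip E) k y x := by
  induction k generalizing y with
  | zero => exact (show x = y from h).symm
  | succ k ih =>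
    obtain ⟨z, hz, hzy⟩ := h
    exact ((walk_one.2 hzy : Walk (flip E) 1 y z).trans (ih hz)).cast (by ring)

theorem walk_flip {E : V → V → Prop} {k : ℕ} {x y : V} :
    Walk (flip E) k y x ↔ Walk E k x y :=
  ⟨fun h => h.reverse, fun h => h.reverse⟩

theorem Walk.exists_fun {E : V → V → Prop} {k : ℕ} {x y : V} (h : Walk E k x y) :
    ∃ w : ℕ → V, w 0 = x ∧ w k = y ∧ ∀ i < k, E (w i) (w (i + 1)) := by
  induction k generalizing y with
  | zero => exact ⟨fun _ => x, rfl, h, by simp⟩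
  | succ k ih =>
    obtain ⟨z, hz, hzy⟩ := h
    obtain ⟨w, h0, hk, hw⟩ := ih hz
    refine ⟨fun i => if i ≤ k then w i else y, by simpa using h0, by simp, fun i hi => ?_⟩
    rcases (Nat.lt_succ_iff_lt_or_eq.1 hi) with hi | rfl
    · simpa [hi.le, Nat.succ_le_of_lt hi] using hw i hi
    · simpa [hk] using hzy

open Classical in
/-- The set of vertices reached from `x` by a walk of length exactly `k`. -/
noncomputable def reach [Fintype V] (E : V → V → Prop) (k : ℕ) (x : V) : Finset V :=
  Finset.univ.filter (Walk E k x)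

open Classical in
/-- The set of vertices reached from `x` by a walk of length between `1` and `k`. -/
noncomputable def ball [Fintype V] (E : V → V → Prop) (k : ℕ) (x : V) : Finset V :=
  Finset.univ.filter fun y => ∃ i, 1 ≤ i ∧ i ≤ k ∧ Walk E i x y

section Counting

variable [Fintype V] {E : V → V → Prop}

@[simp] theorem mem_reach {k : ℕ} {x y : V} : y ∈ reach E k x ↔ Walk E k x y := by
  simp [reach]

@[simp] theorem mem_ball {k : ℕ} {x y : V} :
    y ∈ ball E k x ↔ ∃ i, 1 ≤ i ∧ i ≤ k ∧ Walk E i x y := by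
  simp [ball]

theorem card_add_card_le {A B : Finset V} (h : Disjoint A B) :
    A.card + B.card ≤ Fintype.card V := by
  classical
  rw [← Finset.card_union_of_disjoint h]
  exact Finset.card_le_univ _

omit [Fintype V] in
open Classical in
theorem exists_le_indegree {R : V → V → Prop} {S : Finset V} (hS : S.Nonempty) {a : ℕ}
    (h : ∀ v ∈ S, a ≤ (S.filter (R v)).card) :
    ∃ v ∈ S, a ≤ (S.filter fun u => R u v).card := by
  by_contra! hc
  have h1 : S.card * a ≤ ∑ v ∈ S, (S.filter (R v)).card := by
    simpa using Finset.card_nsmul_le_sum S _ a h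
  have h2 : ∑ v ∈ S, (S.filter fun u => R u v).card < ∑ _v ∈ S, a :=
    Finset.sum_lt_sum_of_nonempty hS hc
  have h3 := Finset.sum_card_bipartiteAbove_eq_sum_card_bipartiteBelow (s := S) (t := S) R
  simp only [Finset.bipartiteAbove, Finset.bipartiteBelow] at h3
  rw [Finset.sum_const, smul_eq_mul] at h2
  exact absurd (h1.trans_eq (by convert h3)) h2.not_ge

/-- The Caccetta–Häggkvist argument: a digraph without closed walks of length at most three has,
within each nonempty vertex set, a vertex of small outdegree. -/
theorem exists_outdegree_lt_two_fifths [DecidableEq V]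
    (hE : ∀ x, ∀ i, 1 ≤ i → i ≤ 3 → ¬ Walk E i x x) (S : Finset V) (hS : S.Nonempty) :
    ∃ v ∈ S, 5 * (S ∩ reach E 1 v).card < 2 * S.card := by
  classical
  induction hm : S.card using Nat.strong_induction_on generalizing S with
  | _ m ih =>
  subst hm
  by_contra! hc
  obtain ⟨v, hv, hin⟩ := exists_le_indegree (R := E) (a := (2 * S.card + 4) / 5) hS
    (fun v hv => by
      have := hc v hv
      have h2 : S ∩ reach E 1 v = S.filter (E v) := by ext; simp [walk_one]
      rw [h2] at this
      omega)
  have hv' := hc v hv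
  have hpos : 0 < S.card := hS.card_pos
  set A := S ∩ reach E 1 v with hA
  have hvA : v ∉ A := by simpa [hA] using fun _ => hE v 1 le_rfl (by norm_num)
  have hAS : A ⊂ S := by
    refine Finset.ssubset_iff_subset_ne.2 ⟨Finset.inter_subset_left, fun h => hvA (h ▸ hv)⟩
  obtain ⟨u, hu, hlt⟩ := ih _ (Finset.card_lt_card hAS) A
    (Finset.card_pos.1 (by omega)) rfl
  have hu' := hc u (hAS.1 hu)
  have hEu : Walk E 1 v u := by simpa using (Finset.mem_inter.1 hu).2
  set I := S.filter fun u => E u v with hI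
  set B := S ∩ reach E 1 u with hB
  have h1 : B.card ≤ (A ∩ reach E 1 u).card + (B \ A).card := by
    rw [← Finset.card_inter_add_card_sdiff B A]
    refine Nat.add_le_add_right (Finset.card_le_card fun w => ?_) _
    simp only [hB, Finset.mem_inter]; tauto
  have h2 : (A ∪ B).card = A.card + (B \ A).card := by
    rw [← Finset.union_sdiff_self_eq_union, Finset.card_union_of_disjoint Finset.disjoint_sdiff]
  have h3 : Disjoint (A ∪ B) I := by
    rw [Finset.disjoint_left]
    intro w hw hwI
    have hwv : Walk E 1 w v := walk_one.2 (Finset.mem_filter.1 hwI).2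
    rcases Finset.mem_union.1 hw with hw | hw
    · have : Walk E 1 v w := by simpa using (Finset.mem_inter.1 hw).2
      exact hE v 2 (by norm_num) (by norm_num) (this.trans hwv)
    · have : Walk E 1 u w := by simpa using (Finset.mem_inter.1 hw).2
      exact hE v 3 (by norm_num) (by norm_num) ((hEu.trans this).trans hwv)
  have h4 : (A ∪ B).card + I.card ≤ S.card := by
    rw [← Finset.card_union_of_disjoint h3]
    refine Finset.card_le_card ?_
    intro w; simp [hA, hB, hI]; tauto
  omega

/-- The analogue of `exists_outdegree_lt_two_fifths` without closed walks of length at most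
four. -/
theorem exists_outdegree_lt_third [DecidableEq V]
    (hE : ∀ x, ∀ i, 1 ≤ i → i ≤ 4 → ¬ Walk E i x x) (S : Finset V) (hS : S.Nonempty) :
    ∃ v ∈ S, 3 * (S ∩ reach E 1 v).card < 1 * S.card := by
  classical
  induction hm : S.card using Nat.strong_induction_on generalizing S with
  | _ m ih =>
  subst hm
  by_contra! hc
  obtain ⟨v, hv, hin⟩ := exists_le_indegree (R := E) (a := (S.card + 2) / 3) hS
    (fun v hv => by
      have := hc v hv
      have h2 : S ∩ reach E 1 v = S.filter (E v) := by ext; simp [walk_one]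
      rw [h2] at this
      omega)
  have hpos : 0 < S.card := hS.card_pos
  have grow : ∀ j, 1 ≤ j → j ≤ 2 → ∀ A ⊆ S, A.Nonempty → A ⊆ ball E j v →
      ∃ B ⊆ S, B.Nonempty ∧ B ⊆ ball E (j + 1) v ∧ 2 * A.card + S.card ≤ 3 * B.card := by
    intro j hj1 hj A hAS hA hAj
    have hvA : v ∉ A := fun h => by
      obtain ⟨i, h1, h2, h3⟩ := mem_ball.1 (hAj h)
      exact hE v i h1 (by omega) h3
    have hAS' : A ⊂ S := Finset.ssubset_iff_subset_ne.2 ⟨hAS, fun h => hvA (h ▸ hv)⟩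
    obtain ⟨u, hu, hlt⟩ := ih _ (Finset.card_lt_card hAS') A hA rfl
    have hu' := hc u (hAS hu)
    set B := S ∩ reach E 1 u with hB
    have h1 : B.card ≤ (A ∩ reach E 1 u).card + (B \ A).card := by
      rw [← Finset.card_inter_add_card_sdiff B A]
      refine Nat.add_le_add_right (Finset.card_le_card fun w => ?_) _
      simp only [hB, Finset.mem_inter]; tauto
    have h2 : (A ∪ B).card = A.card + (B \ A).card := by
      rw [← Finset.union_sdiff_self_eq_union, Finset.card_union_of_disjoint Finset.disjoint_sdiff]
    refine ⟨A ∪ B, Finset.union_subset hAS Finset.inter_subset_left, hA.mono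
      Finset.subset_union_left, ?_, by omega⟩
    intro w hw
    rcases Finset.mem_union.1 hw with hw | hw
    · obtain ⟨i, h1, h2, h3⟩ := mem_ball.1 (hAj hw)
      exact mem_ball.2 ⟨i, h1, by omega, h3⟩
    · obtain ⟨i, h1, h2, h3⟩ := mem_ball.1 (hAj hu)
      exact mem_ball.2 ⟨i + 1, by omega, by omega,
        h3.trans (by simpa using (Finset.mem_inter.1 hw).2)⟩
  have hv' := hc v hv
  obtain ⟨B, hBS, hB, hBv, hBc⟩ := grow 1 le_rfl (by norm_num) (S ∩ reach E 1 v)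
    Finset.inter_subset_left (Finset.card_pos.1 (by omega))
    (fun w hw => mem_ball.2 ⟨1, le_rfl, le_rfl, by simpa using (Finset.mem_inter.1 hw).2⟩)
  obtain ⟨C, hCS, hC, hCv, hCc⟩ := grow 2 (by norm_num) le_rfl B hBS hB hBv
  set I := S.filter fun u => E u v with hI
  have h3 : Disjoint C I := by
    rw [Finset.disjoint_left]
    intro w hw hwI
    obtain ⟨i, h1, h2, h3⟩ := mem_ball.1 (hCv hw)
    exact hE v (i + 1) (by omega) (by omega) ⟨w, h3, (Finset.mem_filter.1 hwI).2⟩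
  have h4 : C.card + I.card ≤ S.card := by
    rw [← Finset.card_union_of_disjoint h3]
    exact Finset.card_le_card (Finset.union_subset hCS (Finset.filter_subset _ _))
  omega

variable {d : ℕ}

theorem le_card_reach (hd : 0 < d) (hout : ∀ x, d ≤ (reach E 1 x).card) (x : V) (k : ℕ) :
    d ≤ (reach E (k + 1) x).card := by
  induction k with
  | zero => exact hout x
  | succ k ih =>
    obtain ⟨y, hy⟩ := Finset.card_pos.1 (hd.trans_le ih)
    refine (hout y).trans (Finset.card_le_card fun z hz => ?_)
    exact mem_reach.2 ((mem_reach.1 hy).trans (mem_reach.1 hz))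

theorem card_ball_one (hout : ∀ x, d ≤ (reach E 1 x).card) (x : V) :
    d ≤ (ball E 1 x).card :=
  (hout x).trans (Finset.card_le_card fun _ hy => mem_ball.2 ⟨1, le_rfl, le_rfl, mem_reach.1 hy⟩)

theorem card_ball_succ [DecidableEq V] {p q : ℕ} (hp : 0 < d) (hpq : p ≤ q)
    (hsmall : ∀ S : Finset V, S.Nonempty → ∃ v ∈ S, q * (S ∩ reach E 1 v).card < p * S.card)
    (hout : ∀ x, d ≤ (reach E 1 x).card) (x : V) {k : ℕ} (hk : 1 ≤ k) :
    q * d + (q - p) * (ball E k x).card ≤ q * (ball E (k + 1) x).card := by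
  classical
  have hne : (ball E k x).Nonempty := by
    obtain ⟨y, hy⟩ := Finset.card_pos.1 (hp.trans_le (hout x))
    exact ⟨y, mem_ball.2 ⟨1, le_rfl, hk, mem_reach.1 hy⟩⟩
  obtain ⟨u, hu, hlt⟩ := hsmall _ hne
  have hsub : ball E k x ∪ reach E 1 u ⊆ ball E (k + 1) x := by
    intro w hw
    rcases Finset.mem_union.1 hw with hw | hw
    · obtain ⟨i, h1, h2, h3⟩ := mem_ball.1 hw
      exact mem_ball.2 ⟨i, h1, by omega, h3⟩
    · obtain ⟨i, h1, h2, h3⟩ := mem_ball.1 hu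
      exact mem_ball.2 ⟨i + 1, by omega, by omega, h3.trans (mem_reach.1 hw)⟩
  have h1 := Finset.card_le_card hsub
  have h2 := Finset.card_union_add_card_inter (ball E k x) (reach E 1 u)
  have h3 := hout u
  obtain ⟨r, rfl⟩ := Nat.exists_eq_add_of_le hpq
  rw [Nat.add_sub_cancel_left]
  nlinarith [Nat.mul_le_mul_left (p + r) h1, Nat.mul_le_mul_left (p + r) h3,
    congrArg (fun t => (p + r) * t) h2]

theorem exists_walk_of_card_lt {x y : V} {A : Finset V} {a b : ℕ}
    (hA : ∀ z ∈ A, ∃ i, 1 ≤ i ∧ i ≤ a ∧ Walk E i x z)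
    (hcard : Fintype.card V < A.card + (ball (flip E) b y).card) :
    ∃ i, 1 ≤ i ∧ i ≤ a + b ∧ Walk E i x y := by
  by_contra! hc
  refine hcard.not_ge (card_add_card_le (Finset.disjoint_left.2 fun z hz hz' => ?_))
  obtain ⟨i, h1, h2, h3⟩ := hA z hz
  obtain ⟨j, h4, h5, h6⟩ := mem_ball.1 hz'
  exact hc (i + j) (by omega) (by omega) (h3.trans (walk_flip.1 h6))

omit [Fintype V] in
theorem flip_no_closed {P : ℕ → Prop} (hE : ∀ x, ∀ i, P i → ¬ Walk E i x x) :
    ∀ x, ∀ i, P i → ¬ Walk (flip E) i x x :=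
  fun x i hi h => hE x i hi (walk_flip.1 h)

omit [Fintype V] in
theorem card_union_three {A B C : Finset V} [DecidableEq V] (h1 : Disjoint A B)
    (h2 : Disjoint A C) (h3 : Disjoint B C) :
    (A ∪ B ∪ C).card = A.card + B.card + C.card := by
  rw [Finset.card_union_of_disjoint (Finset.disjoint_union_left.2 ⟨h2, h3⟩),
    Finset.card_union_of_disjoint h1]

theorem card_ball_of_le_three (hE : ∀ x, ∀ i, 1 ≤ i ∧ i ≤ 3 → ¬ Walk E i x x)
    (hd : 0 < d) (hdn : 249 * Fintype.card V ≤ 1000 * d)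
    (hout : ∀ x, d ≤ (reach E 1 x).card) (x : V) :
    398 * Fintype.card V ≤ 1000 * (ball E 2 x).card ∧
    487 * Fintype.card V ≤ 1000 * (ball E 3 x).card ∧
    541 * Fintype.card V ≤ 1000 * (ball E 4 x).card := by
  classical
  have hs := exists_outdegree_lt_two_fifths (E := E) fun x i h1 h2 => hE x i ⟨h1, h2⟩
  have h1 := card_ball_one hout x
  have h2 := card_ball_succ hd (by norm_num) hs hout x (k := 1) le_rfl
  have h3 := card_ball_succ hd (by norm_num) hs hout x (k := 2) (by norm_num)
  have h4 := card_ball_succ hd (by norm_num) hs hout x (k := 3) (by norm_num)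
  norm_num at h2 h3 h4
  omega

/-- If all closed walks of length at most ten at `x` have length divisible by four, then the sets
of vertices reached from `x` in numbers of steps that differ modulo four are disjoint. -/
theorem disjoint_reach {x : V} {D a b : ℕ}
    (hx : ∀ i, 1 ≤ i ∧ i ≤ 10 → Walk E i x x → 4 ∣ i)
    (hdist : ∀ y, ∃ i, 1 ≤ i ∧ i ≤ D ∧ Walk E i y x)
    (ha : a + D ≤ 10) (hb : b + D ≤ 10) (hab : a % 4 ≠ b % 4) :
    Disjoint (reach E a x) (reach E b x) := by
  refine Finset.disjoint_left.2 fun z hz hz' => ?_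
  obtain ⟨i, h1, h2, h3⟩ := hdist z
  have h4 := hx _ ⟨by omega, by omega⟩ ((mem_reach.1 hz).trans h3)
  have h5 := hx _ ⟨by omega, by omega⟩ ((mem_reach.1 hz').trans h3)
  omega

theorem exists_walk_le_five (hE : ∀ x, ∀ i, 1 ≤ i ∧ i ≤ 3 → ¬ Walk E i x x)
    (hd : 0 < d) (hdn : 249 * Fintype.card V ≤ 1000 * d)
    (hout : ∀ x, d ≤ (reach E 1 x).card) (hin : ∀ x, d ≤ (reach (flip E) 1 x).card)
    {x : V} (hx : ∀ i, 1 ≤ i ∧ i ≤ 10 → Walk E i x x → 4 ∣ i) (y : V) :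
    ∃ i, 1 ≤ i ∧ i ≤ 5 ∧ Walk E i x y := by
  classical
  have hpos : 0 < Fintype.card V := Fintype.card_pos_iff.2 ⟨x⟩
  have hdiam : ∀ u v, ∃ i, 1 ≤ i ∧ i ≤ 7 ∧ Walk E i u v := by
    intro u v
    have h1 := card_ball_of_le_three hE hd hdn hout u
    have h2 := card_ball_of_le_three (flip_no_closed hE) hd hdn hin v
    exact exists_walk_of_card_lt (A := ball E 3 u) (a := 3) (b := 4)
      (fun z hz => mem_ball.1 hz) (by omega)
  have hdis := fun a b => disjoint_reach (a := a) (b := b) hx (fun y => hdiam y x)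
  have hc := card_union_three (hdis 1 2 (by norm_num) (by norm_num) (by norm_num))
    (hdis 1 3 (by norm_num) (by norm_num) (by norm_num))
    (hdis 2 3 (by norm_num) (by norm_num) (by norm_num))
  have k1 := le_card_reach hd hout x 0
  have k2 := le_card_reach hd hout x 1
  have k3 := le_card_reach hd hout x 2
  have h2 := card_ball_of_le_three (flip_no_closed hE) hd hdn hin y
  norm_num at k1 k2 k3
  refine exists_walk_of_card_lt (a := 3) (b := 2)
    (A := reach E 1 x ∪ reach E 2 x ∪ reach E 3 x) (fun z hz => ?_) (by omega)
  simp only [Finset.mem_union, mem_reach] at hz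
  rcases hz with (hz | hz) | hz
  · exact ⟨1, by norm_num, by norm_num, hz⟩
  · exact ⟨2, by norm_num, by norm_num, hz⟩
  · exact ⟨3, by norm_num, by norm_num, hz⟩

/-- If all closed walks of length at most ten at some vertex have length divisible by four, then
the digraph is homomorphic to the directed four-cycle. -/
theorem exists_hom_of_four_dvd (hE : ∀ x, ∀ i, 1 ≤ i ∧ i ≤ 3 → ¬ Walk E i x x)
    (hd : 0 < d) (hdn : 249 * Fintype.card V ≤ 1000 * d)
    (hout : ∀ x, d ≤ (reach E 1 x).card) (hin : ∀ x, d ≤ (reach (flip E) 1 x).card)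
    {x : V} (hx : ∀ i, 1 ≤ i ∧ i ≤ 10 → Walk E i x x → 4 ∣ i) :
    ∃ f : V → ZMod 4, ∀ u v, E u v → f v = f u + 1 := by
  classical
  have hpos : 0 < Fintype.card V := Fintype.card_pos_iff.2 ⟨x⟩
  have hfrom := exists_walk_le_five hE hd hdn hout hin hx
  have hto : ∀ y, ∃ i, 1 ≤ i ∧ i ≤ 5 ∧ Walk E i y x := by
    intro y
    obtain ⟨i, h1, h2, h3⟩ := exists_walk_le_five (E := flip E) (flip_no_closed hE) hd hdn hin
      hout (x := x) (fun i hi h => hx i hi (walk_flip.1 h)) y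
    exact ⟨i, h1, h2, walk_flip.1 h3⟩
  choose f hf1 hf5 hf using hfrom
  choose g hg1 hg5 hg using hto
  have hfg : ∀ y, 4 ∣ f y + g y := fun y =>
    hx _ ⟨by have := hf1 y; omega, by have := hf5 y; have := hg5 y; omega⟩ ((hf y).trans (hg y))
  refine ⟨fun y => (f y : ZMod 4), fun z w hzw => ?_⟩
  suffices h : 4 ∣ f z + 1 + g w by
    have h1 := hfg w
    have h2 : f w ≡ f z + 1 [MOD 4] := by unfold Nat.ModEq; omega
    simpa using (ZMod.natCast_eq_natCast_iff _ _ _).2 h2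
  by_contra hndvd
  have hwalk : Walk E (f z + 1 + g w) x x := ((hf z).trans (walk_one.2 hzw)).trans (hg w)
  have hlong : ¬ f z + 1 + g w ≤ 10 := fun h => hndvd (hx _ ⟨by omega, h⟩ hwalk)
  have hz5 := hf5 z
  have hw5 := hg5 w
  have hgz : g z = 3 := by have := hfg z; have := hg5 z; have := hg1 z; omega
  have hfw : f w = 3 := by have := hfg w; have := hf5 w; have := hf1 w; omega
  have hdis := fun a b => disjoint_reach (a := a) (b := b) hx (fun y => ⟨g y, hg1 y, hg5 y, hg y⟩)
  have hc := card_union_three (hdis 1 2 (by norm_num) (by norm_num) (by norm_num))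
    (hdis 1 3 (by norm_num) (by norm_num) (by norm_num))
    (hdis 2 3 (by norm_num) (by norm_num) (by norm_num))
  have hmem : ∀ u, u ∈ reach E 1 x ∪ reach E 2 x ∪ reach E 3 x →
      ∃ j, 1 ≤ j ∧ j ≤ 3 ∧ Walk E j x u := by
    intro u hu
    simp only [Finset.mem_union, mem_reach] at hu
    rcases hu with (hu | hu) | hu
    · exact ⟨1, by norm_num, by norm_num, hu⟩
    · exact ⟨2, by norm_num, by norm_num, hu⟩
    · exact ⟨3, by norm_num, by norm_num, hu⟩
  have hdz : Disjoint (reach E 1 x ∪ reach E 2 x ∪ reach E 3 x) (reach (flip E) 1 z) := by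
    refine Finset.disjoint_left.2 fun u hu huz => ?_
    obtain ⟨j, h1, h2, h3⟩ := hmem u hu
    have huz : Walk E 1 u z := walk_flip.1 (mem_reach.1 huz)
    have := hx _ ⟨by omega, by omega⟩ ((h3.trans huz).trans (hg z))
    omega
  have hdw : Disjoint (reach E 1 x ∪ reach E 2 x ∪ reach E 3 x) (reach E 1 w) := by
    refine Finset.disjoint_left.2 fun u hu huw => ?_
    obtain ⟨j, h1, h2, h3⟩ := hmem u hu
    have huw : Walk E 1 w u := mem_reach.1 huw
    have h4 := hg1 u
    have h5 := hg5 u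
    have h6 := hx _ ⟨by omega, by omega⟩ (h3.trans (hg u))
    have h7 := hx _ ⟨by omega, by omega⟩ (((hf w).trans huw).trans (hg u))
    omega
  have hzw' : Disjoint (reach (flip E) 1 z) (reach E 1 w) := by
    refine Finset.disjoint_left.2 fun u hu huw => ?_
    exact hE u 3 (by norm_num)
      (((walk_flip.1 (mem_reach.1 hu)).trans (walk_one.2 hzw)).trans (mem_reach.1 huw))
  have hfive := card_union_three hdz hdw hzw'
  have hle := Finset.card_le_univ
    ((reach E 1 x ∪ reach E 2 x ∪ reach E 3 x) ∪ reach (flip E) 1 z ∪ reach E 1 w)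
  have k1 := le_card_reach hd hout x 0
  have k2 := le_card_reach hd hout x 1
  have k3 := le_card_reach hd hout x 2
  have k4 := hin z
  have k5 := hout w
  norm_num at k1 k2 k3
  omega

omit [Fintype V] in
theorem mul_le_card_biUnion_add [DecidableEq V] {A : ℕ → Finset V} {a t : ℕ}
    (hA : ∀ i, a ≤ (A i).card) (k : ℕ)
    (ht : ∀ i j, i < j → j < k → (A i ∩ A j).card ≤ t) :
    k * a ≤ ((Finset.range k).biUnion A).card + k * k * t := by
  induction k with
  | zero => simp
  | succ k ih =>
    have h1 := ih fun i j hij hj => ht i j hij (by omega)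
    have h2 := Finset.card_union_add_card_inter (A k) ((Finset.range k).biUnion A)
    have h3 : (A k ∩ (Finset.range k).biUnion A).card ≤ k * t := by
      rw [Finset.inter_biUnion]
      refine (Finset.card_biUnion_le_card_mul _ _ t fun i hi => ?_).trans (by simp)
      rw [Finset.inter_comm]
      exact ht i k (Finset.mem_range.1 hi) (by omega)
    rw [Finset.range_add_one, Finset.biUnion_insert]
    nlinarith [hA k]

theorem card_ball_three_of_le_four (hE : ∀ x, ∀ i, 1 ≤ i ∧ i ≤ 4 → ¬ Walk E i x x)
    (hd : 0 < d) (hdn : 249 * Fintype.card V ≤ 1000 * d)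
    (hout : ∀ x, d ≤ (reach E 1 x).card) (x : V) :
    525 * Fintype.card V ≤ 1000 * (ball E 3 x).card := by
  classical
  have hs := exists_outdegree_lt_third (E := E) fun x i h1 h2 => hE x i ⟨h1, h2⟩
  have h1 := card_ball_one hout x
  have h2 := card_ball_succ hd (by norm_num) hs hout x (k := 1) le_rfl
  have h3 := card_ball_succ hd (by norm_num) hs hout x (k := 2) (by norm_num)
  norm_num at h2 h3
  omega

theorem exists_walk_le_six (hE : ∀ x, ∀ i, 1 ≤ i ∧ i ≤ 4 → ¬ Walk E i x x)
    (hd : 0 < d) (hdn : 249 * Fintype.card V ≤ 1000 * d)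
    (hout : ∀ x, d ≤ (reach E 1 x).card) (hin : ∀ x, d ≤ (reach (flip E) 1 x).card) (x y : V) :
    ∃ i, 1 ≤ i ∧ i ≤ 6 ∧ Walk E i x y := by
  have hpos : 0 < Fintype.card V := Fintype.card_pos_iff.2 ⟨x⟩
  have h1 := card_ball_three_of_le_four hE hd hdn hout x
  have h2 := card_ball_three_of_le_four (flip_no_closed hE) hd hdn hin y
  exact exists_walk_of_card_lt (A := ball E 3 x) (a := 3) (b := 3)
    (fun z hz => mem_ball.1 hz) (by omega)

theorem card_reach_two_le (hE : ∀ x, ∀ i, 1 ≤ i ∧ i ≤ 4 ∨ i = 6 ∨ i = 8 → ¬ Walk E i x x)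
    (hd : 0 < d) (hdn : 249 * Fintype.card V ≤ 1000 * d)
    (hout : ∀ x, d ≤ (reach E 1 x).card) (hin : ∀ x, d ≤ (reach (flip E) 1 x).card) (x : V) :
    (reach E 2 x).card + 3 * d ≤ Fintype.card V := by
  classical
  have hdiam := exists_walk_le_six (fun x i hi => hE x i (Or.inl hi)) hd hdn hout hin
  have h12 : Disjoint (reach E 2 x) (reach E 1 x) := by
    refine Finset.disjoint_left.2 fun z hz hz' => ?_
    obtain ⟨k, h1, h2, h3⟩ := hdiam z x
    have h4 : ¬ (_ ∨ _) := fun h => hE x _ h ((mem_reach.1 hz).trans h3)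
    have h5 : ¬ (_ ∨ _) := fun h => hE x _ h ((mem_reach.1 hz').trans h3)
    omega
  have h12' : Disjoint (reach (flip E) 1 x) (reach (flip E) 2 x) := by
    refine Finset.disjoint_left.2 fun z hz hz' => ?_
    obtain ⟨k, h1, h2, h3⟩ := hdiam x z
    have h4 : ¬ (_ ∨ _) := fun h => hE x _ h (h3.trans (walk_flip.1 (mem_reach.1 hz)))
    have h5 : ¬ (_ ∨ _) := fun h => hE x _ h (h3.trans (walk_flip.1 (mem_reach.1 hz')))
    omega
  have hmix : ∀ i j, 1 ≤ i → 1 ≤ j → i + j ≤ 4 → Disjoint (reach E i x) (reach (flip E) j x) :=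
    fun i j hi hj hij => Finset.disjoint_left.2 fun z hz hz' =>
      hE x (i + j) (Or.inl ⟨by omega, hij⟩)
        ((mem_reach.1 hz).trans (walk_flip.1 (mem_reach.1 hz')))
  have h := card_add_card_le (A := reach E 2 x ∪ reach E 1 x)
    (B := reach (flip E) 1 x ∪ reach (flip E) 2 x) (by
      simp only [Finset.disjoint_union_left, Finset.disjoint_union_right]
      exact ⟨⟨hmix 2 1 (by norm_num) (by norm_num) (by norm_num),
        hmix 1 1 (by norm_num) (by norm_num) (by norm_num)⟩,
        hmix 2 2 (by norm_num) (by norm_num) (by norm_num),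
        hmix 1 2 (by norm_num) (by norm_num) (by norm_num)⟩)
  rw [Finset.card_union_of_disjoint h12, Finset.card_union_of_disjoint h12'] at h
  have k1 := hout x
  have k2 := hin x
  have k3 := le_card_reach hd hin x 1
  norm_num at k3
  omega

theorem card_sdiff_reach_le [DecidableEq V] {y : ℕ → V} {s : ℕ} (hy : ∀ i, E (y i) (y (i + 1)))
    (hout : ∀ x, d ≤ (reach E 1 x).card) (htwo : ∀ x, (reach E 2 x).card ≤ d + s) (hs : s < d)
    (m i : ℕ) {v : V} (hv : E (y i) v) :
    (reach E 1 (y (i + m + 1)) \ reach E (m + 1) v).card ≤ s := by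
  have base : ∀ i v, E (y i) v → (reach E 1 (y (i + 1)) \ reach E 1 v).card ≤ s := by
    intro i v hv
    have h1 : reach E 1 (y (i + 1)) ∪ reach E 1 v ⊆ reach E 2 (y i) := by
      intro z hz
      rcases Finset.mem_union.1 hz with hz | hz
      · exact mem_reach.2 ((walk_one.2 (hy i)).trans (mem_reach.1 hz))
      · exact mem_reach.2 ((walk_one.2 hv).trans (mem_reach.1 hz))
    have h2 := Finset.card_le_card h1
    have h3 : (reach E 1 (y (i + 1)) \ reach E 1 v).card + (reach E 1 v).card
        = (reach E 1 (y (i + 1)) ∪ reach E 1 v).card := Finset.card_sdiff_add_card _ _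
    have := htwo (y i)
    have := hout v
    omega
  induction m generalizing i v with
  | zero => exact base i v hv
  | succ m ih =>
    obtain ⟨w, hw⟩ : (reach E 1 (y (i + 1)) ∩ reach E 1 v).Nonempty := by
      have h1 := base i v hv
      have h2 := Finset.card_inter_add_card_sdiff (reach E 1 (y (i + 1))) (reach E 1 v)
      have h3 := hout (y (i + 1))
      exact Finset.card_pos.1 (by omega)
    rw [Finset.mem_inter, mem_reach, mem_reach] at hw
    have h1 := ih (i + 1) (walk_one.1 hw.1)
    rw [show i + (m + 1) + 1 = i + 1 + m + 1 by ring]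
    refine le_trans (Finset.card_le_card (Finset.sdiff_subset_sdiff le_rfl fun z hz => ?_)) h1
    exact mem_reach.2 ((hw.2.trans (mem_reach.1 hz)).cast (by ring))

theorem isEmpty_of_no_closed_four
    (hE : ∀ x, ∀ i, 1 ≤ i ∧ i ≤ 4 ∨ i = 6 ∨ i = 8 → ¬ Walk E i x x)
    (hd : 0 < d) (hdn : 249 * Fintype.card V ≤ 1000 * d)
    (hout : ∀ x, d ≤ (reach E 1 x).card) (hin : ∀ x, d ≤ (reach (flip E) 1 x).card) :
    IsEmpty V := by
  classical
  refine ⟨fun x => ?_⟩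
  have hpos : 0 < Fintype.card V := Fintype.card_pos_iff.2 ⟨x⟩
  have hnext : ∀ u, ∃ v, E u v := fun u => by
    obtain ⟨v, hv⟩ := Finset.card_pos.1 (hd.trans_le (hout u))
    exact ⟨v, walk_one.1 (mem_reach.1 hv)⟩
  choose next hnext using hnext
  set y : ℕ → V := fun i => next^[i] x with hydef
  have hy : ∀ i, E (y i) (y (i + 1)) := fun i => by
    simp only [hydef, Function.iterate_succ_apply']
    exact hnext _
  have htwo := card_reach_two_le hE hd hdn hout hin
  have hclose := card_sdiff_reach_le (s := Fintype.card V - 4 * d) hy hout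
    (fun u => by have := htwo u; omega) (by omega)
  obtain ⟨i, m, hm, hW⟩ : ∃ i m, m + 1 ≤ 4 ∧ 2 * (Fintype.card V - 4 * d) <
      (reach E 1 (y i) ∩ reach E 1 (y (i + m + 1))).card := by
    by_contra! hc
    have h1 := mul_le_card_biUnion_add (A := fun i => reach E 1 (y i)) (fun i => hout (y i)) 5
      (t := 2 * (Fintype.card V - 4 * d)) (fun i j hij hj => by
        have := hc i (j - i - 1) (by omega)
        rwa [show i + (j - i - 1) + 1 = j by omega] at this)
    have h2 := Finset.card_le_univ ((Finset.range 5).biUnion fun i => reach E 1 (y i))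
    omega
  set W := reach E 1 (y i) ∩ reach E 1 (y (i + m + 1)) with hWdef
  have hdeg : ∀ v ∈ W, W.card / 2 + 1 ≤ (W.filter (Walk E (m + 1) v)).card := by
    intro v hv
    rw [hWdef, Finset.mem_inter, mem_reach, mem_reach] at hv
    have h1 := hclose m i (walk_one.1 hv.1)
    have h2 : (W \ reach E (m + 1) v).card ≤ Fintype.card V - 4 * d :=
      (Finset.card_le_card (Finset.sdiff_subset_sdiff Finset.inter_subset_right le_rfl)).trans h1
    have h3 := Finset.card_inter_add_card_sdiff W (reach E (m + 1) v)
    have h4 : W ∩ reach E (m + 1) v = W.filter (Walk E (m + 1) v) := by ext; simp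
    rw [h4] at h3
    omega
  obtain ⟨v, hv, hvin⟩ := exists_le_indegree (Finset.card_pos.1 (by omega)) hdeg
  have hvout := hdeg v hv
  have hdisj : Disjoint (W.filter (Walk E (m + 1) v)) (W.filter fun u => Walk E (m + 1) u v) := by
    refine Finset.disjoint_left.2 fun u hu hu' => ?_
    exact hE v (m + 1 + (m + 1)) (by omega)
      ((Finset.mem_filter.1 hu).2.trans (Finset.mem_filter.1 hu').2)
  have h1 := Finset.card_le_card (Finset.union_subset
    (Finset.filter_subset (Walk E (m + 1) v) W)
    (Finset.filter_subset (fun u => Walk E (m + 1) u v) W))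
  rw [Finset.card_union_of_disjoint hdisj] at h1
  omega

/-- Version of the main theorem over an arbitrary finite vertex type. -/
theorem exists_hom {ℓ : ℕ} (hℓ : 18 ≤ ℓ) (h6 : 6 ∣ ℓ) (h12 : ¬ 12 ∣ ℓ)
    (hE : ∀ x, ¬ Walk E ℓ x x)
    (hd : 0 < d) (hdn : 249 * Fintype.card V ≤ 1000 * d)
    (hout : ∀ x, d ≤ (reach E 1 x).card) (hin : ∀ x, d ≤ (reach (flip E) 1 x).card) :
    ∃ f : V → ZMod 4, ∀ u v, E u v → f v = f u + 1 := by
  have hdvd : ∀ x i, i ∣ ℓ → ¬ Walk E i x x := by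
    rintro x i ⟨c, rfl⟩ h
    exact hE x ((h.iterate c).cast (by ring))
  have hcomb : ∀ x i j a b, a * i + b * j = ℓ → Walk E i x x → ¬ Walk E j x x :=
    fun x i j a b hab hi hj => hE x (((hi.iterate a).trans (hj.iterate b)).cast hab)
  have hE3 : ∀ x, ∀ i, 1 ≤ i ∧ i ≤ 3 → ¬ Walk E i x x := by
    rintro x i ⟨h1, h2⟩
    exact hdvd x i (by interval_cases i <;> omega)
  by_cases h4 : ∃ x, Walk E 4 x x
  · obtain ⟨x, hx⟩ := h4
    refine exists_hom_of_four_dvd hE3 hd hdn hout hin (x := x) ?_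
    obtain ⟨k, rfl⟩ : ∃ k, ℓ = 18 + 12 * k := ⟨(ℓ - 18) / 12, by omega⟩
    rintro i ⟨h1, h2⟩ h
    interval_cases i
    · exact absurd h (hdvd x 1 (by omega))
    · exact absurd h (hdvd x 2 (by omega))
    · exact absurd h (hdvd x 3 (by omega))
    · norm_num
    · exact absurd h (hcomb x 4 5 (2 + 3 * k) 2 (by ring) hx)
    · exact absurd h (hdvd x 6 (by omega))
    · exact absurd h (hcomb x 4 7 (1 + 3 * k) 2 (by ring) hx)
    · norm_num
    · exact absurd h (hcomb x 4 9 (3 * k) 2 (by ring) hx)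
    · exact absurd h (hcomb x 4 10 (2 + 3 * k) 1 (by ring) hx)
  · push Not at h4
    have hE4 : ∀ x, ∀ i, 1 ≤ i ∧ i ≤ 4 → ¬ Walk E i x x := by
      rintro x i ⟨h1, h2⟩
      rcases h2.lt_or_eq with h2 | rfl
      · exact hE3 x i ⟨h1, by omega⟩
      · exact h4 x
    have h5 : ∀ x, Walk E 5 x x := by
      intro x
      obtain ⟨i, h1, h2, h3⟩ := exists_walk_le_six hE4 hd hdn hout hin x x
      have h4 : ¬ i ≤ 4 := fun h => hE4 x i ⟨h1, h⟩ h3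
      have h6' : i ≠ 6 := by rintro rfl; exact hdvd x 6 h6 h3
      exact h3.cast (by omega)
    have h8 : ∀ x, ¬ Walk E 8 x x := by
      intro x
      obtain ⟨a, b, hab⟩ : ∃ a b, a * 5 + b * 8 = ℓ := by
        have : ∃ b, b ≤ 4 ∧ 8 * b ≤ ℓ ∧ (ℓ - 8 * b) % 5 = 0 := by
          have h : ℓ % 5 = 0 ∨ ℓ % 5 = 1 ∨ ℓ % 5 = 2 ∨ ℓ % 5 = 3 ∨ ℓ % 5 = 4 := by omega
          rcases h with h | h | h | h | h
          · exact ⟨0, by omega⟩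
          · exact ⟨2, by omega⟩
          · exact ⟨4, by omega⟩
          · exact ⟨1, by omega⟩
          · exact ⟨3, by omega⟩
        obtain ⟨b, -, hb, h⟩ := this
        exact ⟨(ℓ - 8 * b) / 5, b, by omega⟩
      exact hcomb x 5 8 a b hab (h5 x)
    have := isEmpty_of_no_closed_four (E := E) (by
      rintro x i (h | rfl | rfl)
      · exact hE4 x i h
      · exact hdvd x 6 h6
      · exact h8 x) hd hdn hout hin
    exact ⟨fun _ => 0, fun u => isEmptyElim u⟩

end Counting

end ClosedWalks

/-- For `ℓ ≥ 18` divisible by `6` but not by `12`: there are `ε > 0` and `n₀` such that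
every oriented graph on `n ≥ n₀` vertices with minimum semidegree at least `n/4 - εn`
that has no closed directed walk of length `ℓ` is homomorphic to `C₄`. -/
theorem hom_to_c4_of_no_closed_walk (ℓ : ℕ) (hℓ : 18 ≤ ℓ) (h6 : 6 ∣ ℓ) (h12 : ¬ 12 ∣ ℓ) :
    ∃ ε : ℝ, 0 < ε ∧ ∃ n₀ : ℕ, ∀ n : ℕ, n₀ ≤ n →
      ∀ E : Fin n → Fin n → Prop, Oriented E →
      (∀ v, (n : ℝ) / 4 - ε * n ≤ (semiDeg E v : ℝ)) →
      ¬ HasClosedWalk E ℓ →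
      HomToCycle E 4 := by
  refine ⟨1 / 1000, by norm_num, 1, fun n hn E hor hdeg hno => ?_⟩
  have hn' : 0 < n := hn
  have hdeg' : ∀ v, (249 * n + 999) / 1000 ≤ semiDeg E v := by
    intro v
    have h1 := hdeg v
    have h2 : ((249 * n : ℕ) : ℝ) ≤ ((1000 * semiDeg E v : ℕ) : ℝ) := by
      push_cast
      linarith
    have h3 : 249 * n ≤ 1000 * semiDeg E v := by exact_mod_cast h2
    omega
  refine ClosedWalks.exists_hom (d := (249 * n + 999) / 1000) hℓ h6 h12
    (fun x hx => ?_) (by omega) (by rw [Fintype.card_fin]; omega) (fun v => ?_) (fun v => ?_)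
  · obtain ⟨w, h0, hl, hw⟩ := hx.exists_fun
    exact hno ⟨w, h0.trans hl.symm, hw⟩
  · refine (hdeg' v).trans ((min_le_left _ _).trans (le_of_eq ?_))
    rw [outDeg, ← Set.ncard_coe_finset]
    congr 1
    ext w
    simp [ClosedWalks.walk_one]
  · refine (hdeg' v).trans ((min_le_right _ _).trans (le_of_eq ?_))
    rw [inDeg, ← Set.ncard_coe_finset]
    congr 1
    ext w
    simp [ClosedWalks.walk_one, flip]
end
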